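/- arXiv:2112.03366 — 2 statements merged into one kernel-verified Lean document; each statement's English description precedes it below -/
import Mathlib

section
/- Let n ≥ 7, let G and H be simple graphs on n vertices that share n−1 cards, and let ℓ be the number of vertices of G of maximum degree Δ(G). Then for every integer r ≥ 1 with r ≠ n − ℓ we have κ_r(G) = κ_r(H). -/
open SimpleGraph

/-- `kappa G r` is the number of `r`-cliques of the graph `G`. -/
noncomputable def kappa {V : Type*} (G : SimpleGraph V) (r : ℕ) : ℕ :=
  (G.cliqueSet r).ncard

/-- `degR G r v` is the number of `r`-cliques of `G` that contain the vertex `v`. -/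
noncomputable def degR {V : Type*} (G : SimpleGraph V) (r : ℕ) (v : V) : ℕ :=
  {s | s ∈ G.cliqueSet r ∧ v ∈ s}.ncard

/-- `deg G v` is the degree of the vertex `v` in `G`. -/
noncomputable def deg {V : Type*} (G : SimpleGraph V) (v : V) : ℕ :=
  (G.neighborSet v).ncard

/-- `gcard G v` is the card `G - v`: the induced subgraph of `G` on `V(G) \ {v}`. -/
def gcard {V : Type*} (G : SimpleGraph V) (v : V) : SimpleGraph {x : V // x ≠ v} :=
  G.induce {x : V | x ≠ v}

/-- The maximum degree `Δ(G)`. -/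
noncomputable def maxDeg {n : ℕ} (G : SimpleGraph (Fin n)) : ℕ :=
  Finset.univ.sup (fun v => deg G v)

/-- The minimum degree `δ(G)`. -/
noncomputable def minDeg {n : ℕ} (G : SimpleGraph (Fin n)) : ℕ :=
  sInf (Set.range (fun v => deg G v))

/-- `ℓ(G)`: the number of vertices of maximum degree. -/
noncomputable def numMaxDeg {n : ℕ} (G : SimpleGraph (Fin n)) : ℕ :=
  (Finset.univ.filter (fun v => deg G v = maxDeg G)).card

/-- `G` and `H` share `n-1` cards via the vertices `u`, `w` and the bijection `π`:
for every `v ≠ u`, the card `G - v` is isomorphic to the card `H - π(v)`. -/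
def ShareCardsVia {n : ℕ} (G H : SimpleGraph (Fin n)) (u w : Fin n)
    (π : {x : Fin n // x ≠ u} ≃ {y : Fin n // y ≠ w}) : Prop :=
  ∀ v : {x : Fin n // x ≠ u}, Nonempty (gcard G v.1 ≃g gcard H (π v).1)

/-- `G` and `H` share `n-1` cards. -/
def ShareCards {n : ℕ} (G H : SimpleGraph (Fin n)) : Prop :=
  ∃ (u w : Fin n) (π : {x : Fin n // x ≠ u} ≃ {y : Fin n // y ≠ w}),
    ShareCardsVia G H u w π


section CliqueCount
open scoped Classical

set_option linter.unusedSectionVars false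

variable {V : Type} [Fintype V]

/-- integer adjacency indicator -/
noncomputable def adjZ (G : SimpleGraph V) (x y : V) : ℤ := if G.Adj x y then 1 else 0

/-- integer degree -/
noncomputable def dg (G : SimpleGraph V) (x : V) : ℤ := ∑ y, adjZ G x y

/-- integer clique count -/
noncomputable def KK (G : SimpleGraph V) (r : ℕ) : ℤ :=
  ∑ s : Finset V, if G.IsNClique r s then 1 else 0

/-- integer count of cliques through a vertex -/
noncomputable def DD (G : SimpleGraph V) (r : ℕ) (v : V) : ℤ :=
  ∑ s : Finset V, if G.IsNClique r s ∧ v ∈ s then 1 else 0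

/-- `σ` is an isomorphism from `G - v` to `H - v`, extended to all vertices. -/
def CIs (G H : SimpleGraph V) (v : V) (σ : Equiv.Perm V) : Prop :=
  σ v = v ∧ ∀ x y, x ≠ v → y ≠ v → (G.Adj x y ↔ H.Adj (σ x) (σ y))

/-- The cards at `v` are isomorphic. -/
def CI (G H : SimpleGraph V) (v : V) : Prop := ∃ σ : Equiv.Perm V, CIs G H v σ

lemma CIs.ne {G H : SimpleGraph V} {v : V} {σ : Equiv.Perm V} (h : CIs G H v σ) {x : V}
    (hx : x ≠ v) : σ x ≠ v := by
  intro h1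
  apply hx
  apply σ.injective
  rw [h1, h.1]

lemma CIs.symm {G H : SimpleGraph V} {v : V} {σ : Equiv.Perm V} (h : CIs G H v σ) :
    CIs H G v σ.symm := by
  have h1 : σ.symm v = v := by rw [Equiv.symm_apply_eq, h.1]
  refine ⟨h1, fun x y hx hy => ?_⟩
  have hx' : σ.symm x ≠ v := by
    intro h2; apply hx; rw [Equiv.symm_apply_eq, h.1] at h2; exact h2
  have hy' : σ.symm y ≠ v := by
    intro h2; apply hy; rw [Equiv.symm_apply_eq, h.1] at h2; exact h2
  have := h.2 _ _ hx' hy'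
  simp at this
  exact this.symm

lemma CI.symm {G H : SimpleGraph V} {v : V} (h : CI G H v) : CI H G v := by
  obtain ⟨σ, h⟩ := h
  exact ⟨_, h.symm⟩

lemma CI.compl {G H : SimpleGraph V} {v : V} (h : CI G H v) : CI Gᶜ Hᶜ v := by
  obtain ⟨σ, h⟩ := h
  refine ⟨σ, h.1, fun x y hx hy => ?_⟩
  rw [SimpleGraph.compl_adj, SimpleGraph.compl_adj, h.2 x y hx hy]
  simp

lemma adjZ_comm (G : SimpleGraph V) (x y : V) : adjZ G x y = adjZ G y x := by
  simp [adjZ, G.adj_comm]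

lemma adjZ_self (G : SimpleGraph V) (x : V) : adjZ G x x = 0 := by simp [adjZ]

lemma adjZ_nonneg (G : SimpleGraph V) (x y : V) : 0 ≤ adjZ G x y := by
  unfold adjZ; split_ifs <;> simp

lemma adjZ_le (G : SimpleGraph V) (x y : V) : adjZ G x y ≤ 1 := by
  unfold adjZ; split_ifs <;> simp

lemma adjZ_pos {G : SimpleGraph V} {x y : V} (h : G.Adj x y) : adjZ G x y = 1 := by
  simp [adjZ, h]

lemma adjZ_neg {G : SimpleGraph V} {x y : V} (h : ¬ G.Adj x y) : adjZ G x y = 0 := by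
  simp [adjZ, h]

/-- sum over all but v -/
lemma sum_split (f : V → ℤ) (v : V) : ∑ y, f y = f v + ∑ y, (if y = v then 0 else f y) := by
  have : ∀ y, f y = (if y = v then f v else 0) + (if y = v then 0 else f y) := by
    intro y; split_ifs with h <;> simp [h]
  rw [Finset.sum_congr rfl (fun y _ => this y), Finset.sum_add_distrib]
  simp

lemma CIs.cdeg {G H : SimpleGraph V} {v : V} {σ : Equiv.Perm V} (h : CIs G H v σ) {x : V}
    (hx : x ≠ v) : dg G x - adjZ G x v = dg H (σ x) - adjZ H (σ x) v := by
  unfold dg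
  rw [sum_split (fun y => adjZ G x y) v, sum_split (fun y => adjZ H (σ x) y) v,
    ← Equiv.sum_comp σ (fun y => if y = v then 0 else adjZ H (σ x) y)]
  have : ∀ y, (if y = v then 0 else adjZ G x y) = (if σ y = v then 0 else adjZ H (σ x) (σ y)) := by
    intro y
    by_cases hy : y = v
    · simp [hy, h.1]
    · have := h.ne hy
      simp only [hy, this, if_false, adjZ, h.2 x y hx hy]
  rw [Finset.sum_congr rfl (fun y _ => this y)]
  ring

lemma CIs.degsum {G H : SimpleGraph V} {v : V} {σ : Equiv.Perm V} (h : CIs G H v σ) :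
    (∑ x, dg G x) - 2 * dg G v = (∑ x, dg H x) - 2 * dg H v := by
  have key : ∀ (G : SimpleGraph V), (∑ x, dg G x) - 2 * dg G v =
      ∑ x, (if x = v then 0 else dg G x - adjZ G x v) := by
    intro G
    have h1 : dg G v = ∑ x, adjZ G x v := by
      unfold dg; exact Finset.sum_congr rfl (fun y _ => adjZ_comm _ _ _)
    have h2 := sum_split (fun x => dg G x - adjZ G x v) v
    simp only [Finset.sum_sub_distrib, ← h1, adjZ_self] at h2
    linarith
  rw [key G, key H, ← Equiv.sum_comp σ (fun x => if x = v then 0 else dg H x - adjZ H x v)]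
  refine Finset.sum_congr rfl (fun y _ => ?_)
  by_cases hy : y = v
  · simp [hy, h.1]
  · have := h.ne hy
    simp only [hy, this, if_false]
    exact h.cdeg hy

lemma deg_rel {G H : SimpleGraph V} {u : V} (hc : ∀ v, v ≠ u → CI G H v)
    (hn : 2 ≤ Fintype.card V) :
    ∃ C : ℤ, (∀ v, v ≠ u → dg G v = dg H v + C) ∧
      dg H u = dg G u + ((Fintype.card V : ℤ) - 3) * C := by
  obtain ⟨v0, hv0⟩ : ∃ v : V, v ≠ u := by
    have : Nontrivial V := Fintype.one_lt_card_iff_nontrivial.mp (by omega)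
    exact exists_ne u
  have hs : ∀ v, v ≠ u → (∑ x, dg G x) - 2 * dg G v = (∑ x, dg H x) - 2 * dg H v := by
    intro v hv
    obtain ⟨σ, h⟩ := hc v hv
    exact h.degsum
  refine ⟨dg G v0 - dg H v0, ?_, ?_⟩
  · intro v hv
    have h1 := hs v hv
    have h2 := hs v0 hv0
    linarith
  · have h2 := hs v0 hv0
    have e1 : ∀ v, dg G v = dg H v + (dg G v0 - dg H v0) +
        (if v = u then dg G u - dg H u - (dg G v0 - dg H v0) else 0) := by
      intro v
      split_ifs with h
      · subst h; ring
      · have h1 := hs v h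
        linarith
    have e2 : ∑ x, dg G x = ∑ x, (dg H x + (dg G v0 - dg H v0) +
        (if x = u then dg G u - dg H u - (dg G v0 - dg H v0) else 0)) :=
      Finset.sum_congr rfl (fun v _ => e1 v)
    rw [Finset.sum_add_distrib, Finset.sum_add_distrib] at e2
    simp at e2
    linarith

/-! degree to structure -/

lemma dg_card (G : SimpleGraph V) (x : V) :
    dg G x = ((Finset.univ.filter (fun y => G.Adj x y)).card : ℤ) := by
  simp [dg, adjZ, Finset.sum_boole]

lemma dg_nn (G : SimpleGraph V) (x : V) :
    dg G x = (Fintype.card V : ℤ) - 1 -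
      ((Finset.univ.filter (fun y => y ≠ x ∧ ¬ G.Adj x y)).card : ℤ) := by
  rw [dg_card]
  have h1 := Finset.card_filter_add_card_filter_not (s := (Finset.univ : Finset V)) (fun y => G.Adj x y)
  have h2 : (Finset.univ.filter (fun y => ¬ G.Adj x y)) =
      insert x (Finset.univ.filter (fun y => y ≠ x ∧ ¬ G.Adj x y)) := by
    ext y
    by_cases hy : y = x <;> simp [hy]
  rw [h2, Finset.card_insert_of_notMem (by simp), Finset.card_univ] at h1
  omega

lemma dg_nonneg (G : SimpleGraph V) (x : V) : 0 ≤ dg G x := by rw [dg_card]; positivity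

lemma dg_le (G : SimpleGraph V) (x : V) : dg G x ≤ (Fintype.card V : ℤ) - 1 := by
  rw [dg_nn]; omega

lemma dg_le_miss (G : SimpleGraph V) (x : V) (T : Finset V)
    (hT : ∀ y ∈ T, y ≠ x ∧ ¬ G.Adj x y) : dg G x ≤ (Fintype.card V : ℤ) - 1 - T.card := by
  rw [dg_nn]
  have : T.card ≤ (Finset.univ.filter (fun y => y ≠ x ∧ ¬ G.Adj x y)).card :=
    Finset.card_le_card (fun y hy => by simpa using hT y hy)
  omega

lemma le_dg (G : SimpleGraph V) (x : V) (T : Finset V)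
    (hT : ∀ y ∈ T, G.Adj x y) : (T.card : ℤ) ≤ dg G x := by
  rw [dg_card]
  exact_mod_cast Finset.card_le_card (fun y hy => by simpa using hT y hy)

/-- if all non-neighbours lie in T then degree is at least n-1-|T| -/
lemma le_dg_miss (G : SimpleGraph V) (x : V) (T : Finset V)
    (hT : ∀ y, y ≠ x → ¬ G.Adj x y → y ∈ T) : (Fintype.card V : ℤ) - 1 - T.card ≤ dg G x := by
  rw [dg_nn]
  have : (Finset.univ.filter (fun y => y ≠ x ∧ ¬ G.Adj x y)).card ≤ T.card :=
    Finset.card_le_card (fun y hy => by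
      simp at hy; exact hT y hy.1 hy.2)
  omega

/-- if all neighbours lie in T then degree is at most |T| -/
lemma dg_le_nbr (G : SimpleGraph V) (x : V) (T : Finset V)
    (hT : ∀ y, G.Adj x y → y ∈ T) : dg G x ≤ T.card := by
  rw [dg_card]
  exact_mod_cast Finset.card_le_card (fun y hy => by simp at hy; exact hT y hy)

/-- if T is a set of neighbours of full size then it is the neighbourhood -/
lemma nbr_eq (G : SimpleGraph V) (x : V) (T : Finset V)
    (hT : ∀ y ∈ T, G.Adj x y) (h : dg G x ≤ T.card) : ∀ y, G.Adj x y → y ∈ T := by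
  rw [dg_card] at h
  have h1 : T ⊆ Finset.univ.filter (fun y => G.Adj x y) := fun y hy => by simpa using hT y hy
  have h2 := Finset.eq_of_subset_of_card_le h1 (by exact_mod_cast h)
  intro y hy
  rw [h2]; simpa using hy

lemma nn_eq (G : SimpleGraph V) (x : V) (T : Finset V)
    (hT : ∀ y ∈ T, y ≠ x ∧ ¬ G.Adj x y) (h : (Fintype.card V : ℤ) - 1 - T.card ≤ dg G x) :
    ∀ y, y ≠ x → y ∉ T → G.Adj x y := by
  rw [dg_nn] at h
  have h1 : T ⊆ Finset.univ.filter (fun y => y ≠ x ∧ ¬ G.Adj x y) :=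
    fun y hy => by simpa using hT y hy
  have h2 := Finset.eq_of_subset_of_card_le h1 (by omega)
  intro y hy hyT
  by_contra h3
  apply hyT
  rw [h2]; simp [hy, h3]

lemma exists_notMem (T : Finset V) (h : T.card < Fintype.card V) : ∃ v, v ∉ T := by
  by_contra hh
  push Not at hh
  have : T = Finset.univ := by ext; simp [hh]
  rw [this, Finset.card_univ] at h
  omega

/-- degree one -/
lemma dg_one {G : SimpleGraph V} {x : V} (h : dg G x = 1) :
    ∃ b, G.Adj x b ∧ ∀ y, G.Adj x y → y = b := by
  rw [dg_card] at h
  have h' : (Finset.univ.filter (fun y => G.Adj x y)).card = 1 := by exact_mod_cast h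
  obtain ⟨b, hb⟩ := Finset.card_eq_one.mp h'
  have hb' : ∀ y, G.Adj x y ↔ y = b := by
    intro y
    have := Finset.ext_iff.mp hb y
    simpa using this
  exact ⟨b, (hb' b).2 rfl, fun y hy => (hb' y).1 hy⟩

lemma dg_two {G : SimpleGraph V} {x : V} (h : dg G x = 2) :
    ∃ b c, b ≠ c ∧ G.Adj x b ∧ G.Adj x c ∧ ∀ y, G.Adj x y → y = b ∨ y = c := by
  rw [dg_card] at h
  have h' : (Finset.univ.filter (fun y => G.Adj x y)).card = 2 := by exact_mod_cast h
  obtain ⟨b, c, hbc, hb⟩ := Finset.card_eq_two.mp h'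
  have hb' : ∀ y, G.Adj x y ↔ y = b ∨ y = c := by
    intro y
    have := Finset.ext_iff.mp hb y
    simpa using this
  exact ⟨b, c, hbc, (hb' b).2 (Or.inl rfl), (hb' c).2 (Or.inr rfl), fun y hy => (hb' y).1 hy⟩

lemma dg_miss_one {G : SimpleGraph V} {x : V} (h : dg G x = (Fintype.card V : ℤ) - 2) :
    ∃ b, b ≠ x ∧ ¬ G.Adj x b ∧ ∀ y, y ≠ x → y ≠ b → G.Adj x y := by
  rw [dg_nn] at h
  have h' : (Finset.univ.filter (fun y => y ≠ x ∧ ¬ G.Adj x y)).card = 1 := by omega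
  obtain ⟨b, hb⟩ := Finset.card_eq_one.mp h'
  have hb' : ∀ y, (y ≠ x ∧ ¬ G.Adj x y) ↔ y = b := by
    intro y
    have := Finset.ext_iff.mp hb y
    simpa using this
  refine ⟨b, ((hb' b).2 rfl).1, ((hb' b).2 rfl).2, fun y hy hyb => ?_⟩
  by_contra h3
  exact hyb ((hb' y).1 ⟨hy, h3⟩)

/-- if x has degree n-3 and misses g, then it misses exactly one more vertex. -/
lemma dg_miss_two {G : SimpleGraph V} {x g : V} (h : dg G x = (Fintype.card V : ℤ) - 3)
    (hg : g ≠ x) (hxg : ¬ G.Adj x g) :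
    ∃ b, ∀ y, y ≠ x → y ≠ g → y ≠ b → G.Adj x y := by
  rw [dg_nn] at h
  have h' : (Finset.univ.filter (fun y => y ≠ x ∧ ¬ G.Adj x y)).card = 2 := by omega
  obtain ⟨b, c, hbc, hb⟩ := Finset.card_eq_two.mp h'
  have hb' : ∀ y, (y ≠ x ∧ ¬ G.Adj x y) ↔ y = b ∨ y = c := by
    intro y
    have := Finset.ext_iff.mp hb y
    simpa using this
  rcases (hb' g).1 ⟨hg, hxg⟩ with rfl | rfl
  · refine ⟨c, fun y h1 h2 h3 => ?_⟩
    by_contra h4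
    rcases (hb' y).1 ⟨h1, h4⟩ with h5 | h5
    · exact h2 h5
    · exact h3 h5
  · refine ⟨b, fun y h1 h2 h3 => ?_⟩
    by_contra h4
    rcases (hb' y).1 ⟨h1, h4⟩ with h5 | h5
    · exact h3 h5
    · exact h2 h5

lemma dg_compl (G : SimpleGraph V) (x : V) : dg Gᶜ x = (Fintype.card V : ℤ) - 1 - dg G x := by
  rw [dg_nn G]
  have h : ∀ y, adjZ Gᶜ x y = if (y ≠ x ∧ ¬ G.Adj x y) then 1 else 0 := by
    intro y
    simp only [adjZ, SimpleGraph.compl_adj, ne_comm]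
  unfold dg
  rw [Finset.sum_congr rfl (fun y _ => h y), Finset.sum_boole]
  ring

lemma edge_two {G H : SimpleGraph V} {u : V} (hc : ∀ v, v ≠ u → CI G H v)
    (hn : 7 ≤ Fintype.card V) (hd : ∀ v, v ≠ u → dg G v = dg H v + 1)
    (hG : dg G u = 2) (hH : dg H u = (Fintype.card V : ℤ) - 1) : False := by
  obtain ⟨b, c, hbc, hub, huc, hN⟩ := dg_two hG
  have hbu : b ≠ u := hub.ne'
  have hcu : c ≠ u := huc.ne'
  have hdomu : ∀ y, y ≠ u → H.Adj u y := by
    intro y hy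
    refine nn_eq H u ∅ (by simp) (by simp; omega) y hy (by simp)
  -- every card of G has a dominating vertex in {b,c}
  have hdom : ∀ v, v ≠ u → ∃ x, (x = b ∨ x = c) ∧ x ≠ v ∧ ∀ y, y ≠ v → y ≠ x → G.Adj x y := by
    intro v hv
    obtain ⟨σ, h⟩ := hc v hv
    have hs := h.symm
    have hx : σ.symm u ≠ v := hs.ne hv.symm
    have hx2 : ∀ y, y ≠ v → y ≠ σ.symm u → G.Adj (σ.symm u) y := by
      intro y hy hyx
      rw [h.2 _ _ hx hy]
      simp only [Equiv.apply_symm_apply]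
      apply hdomu
      intro h3
      apply hyx
      rw [← h3]; simp
    have hxu : σ.symm u ≠ u := by
      intro h3
      rw [h3] at hx2
      have : (Fintype.card V : ℤ) - 1 - ({v} : Finset V).card ≤ dg G u := by
        apply le_dg_miss
        intro y hy h4
        by_contra h5
        exact h4 (hx2 y (by simpa using h5) hy)
      simp at this
      omega
    refine ⟨σ.symm u, ?_, hx, hx2⟩
    exact hN _ ((hx2 u hv.symm hxu.symm).symm)
  have hbc' : G.Adj b c := by
    obtain ⟨v, hv⟩ := exists_notMem ({u, b, c} : Finset V)
      (lt_of_le_of_lt Finset.card_le_three (by omega))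
    simp at hv
    obtain ⟨x, hx, _, h2⟩ := hdom v hv.1
    rcases hx with rfl | rfl
    · exact h2 c (Ne.symm hv.2.2) hbc.symm
    · exact (h2 b (Ne.symm hv.2.1) hbc).symm
  have hbd : ∀ y, y ≠ b → G.Adj b y := by
    intro y hy
    by_cases hyc : y = c
    · rw [hyc]; exact hbc'
    · obtain ⟨x, hx, hxc, h2⟩ := hdom c hcu
      rcases hx with rfl | rfl
      · exact h2 y hyc hy
      · exact absurd rfl hxc
  have hcd : ∀ y, y ≠ c → G.Adj c y := by
    intro y hy
    by_cases hyb : y = b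
    · rw [hyb]; exact hbc'.symm
    · obtain ⟨x, hx, hxb, h2⟩ := hdom b hbu
      rcases hx with rfl | rfl
      · exact absurd rfl hxb
      · exact h2 y hyb hy
  have hdb : dg H b = (Fintype.card V : ℤ) - 2 := by
    have h1 := hd b hbu
    have h2 := le_dg_miss G b ∅ (fun y h1 h2 => absurd (hbd y h1) h2)
    have h3 := dg_le G b
    simp at h2
    linarith
  have hdc : dg H c = (Fintype.card V : ℤ) - 2 := by
    have h1 := hd c hcu
    have h2 := le_dg_miss G c ∅ (fun y h1 h2 => absurd (hcd y h1) h2)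
    have h3 := dg_le G c
    simp at h2
    linarith
  obtain ⟨b', _, _, hb'⟩ := dg_miss_one hdb
  obtain ⟨c', _, _, hc'⟩ := dg_miss_one hdc
  obtain ⟨v, hv⟩ := exists_notMem ({u, b, c, b', c'} : Finset V)
      (lt_of_le_of_lt Finset.card_le_five (by omega))
  simp at hv
  obtain ⟨hvu, hvb, hvc, hvb', hvc'⟩ := hv
  obtain ⟨σ, h⟩ := hc v hvu
  -- a dominating vertex of H - v other than u
  have : ∃ x, (x = b ∨ x = c) ∧ σ x ≠ u := by
    by_cases h1 : σ b = u
    · refine ⟨c, Or.inr rfl, fun h2 => hbc (σ.injective (h1.trans h2.symm))⟩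
    · exact ⟨b, Or.inl rfl, h1⟩
  obtain ⟨x, hx, hxu⟩ := this
  have hxv : x ≠ v := by rcases hx with rfl | rfl <;> exact Ne.symm ‹_›
  have hxd : ∀ y, y ≠ x → G.Adj x y := by
    rcases hx with rfl | rfl
    · exact hbd
    · exact hcd
  have hq : ∀ y, y ≠ v → y ≠ σ x → H.Adj (σ x) y := by
    intro y hy hyx
    have h4 : σ.symm y ≠ v := h.symm.ne hy
    have := (h.2 x (σ.symm y) hxv h4).1 (hxd _ (by
      intro h5; apply hyx; rw [← h5]; simp))
    simpa using this
  have hdq : (Fintype.card V : ℤ) - 2 ≤ dg H (σ x) := by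
    have := le_dg_miss H (σ x) {v} (fun y h1 h2 => by
      by_contra h5
      exact h2 (hq y (by simpa using h5) h1))
    simp at this
    linarith
  have hdq2 := hd (σ x) hxu
  have hqu : G.Adj (σ x) u := by
    refine nn_eq G (σ x) ∅ (by simp) (by simp; linarith) u (Ne.symm hxu) (by simp)
  have hqv : ¬ H.Adj (σ x) v := by
    intro h6
    have := le_dg_miss H (σ x) ∅ (fun y h1 h2 => by
      exfalso
      by_cases h7 : y = v
      · rw [h7] at h2; exact h2 h6
      · exact h2 (hq y h7 h1))
    simp at this
    have := dg_le G (σ x)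
    linarith
  rcases hN _ hqu.symm with h7 | h7
  · rw [h7] at hqv
    exact hqv (hb' v hvb hvb')
  · rw [h7] at hqv
    exact hqv (hc' v hvc hvc')

lemma edge_one {G H : SimpleGraph V} {u : V} (hc : ∀ v, v ≠ u → CI G H v)
    (hn : 7 ≤ Fintype.card V) (hd : ∀ v, v ≠ u → dg G v = dg H v + 1)
    (hG : dg G u = 1) (hH : dg H u = (Fintype.card V : ℤ) - 2) : False := by
  obtain ⟨b, hub, hN⟩ := dg_one hG
  obtain ⟨e, heu, hue, hM⟩ := dg_miss_one hH
  have hbu : b ≠ u := hub.ne'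
  -- card e
  have hbe : b ≠ e ∧ ∀ y, y ≠ b → y ≠ e → G.Adj b y := by
    obtain ⟨σ, h⟩ := hc e heu
    have hs := h.symm
    have hx : σ.symm u ≠ e := hs.ne heu.symm
    have hx2 : ∀ y, y ≠ e → y ≠ σ.symm u → G.Adj (σ.symm u) y := by
      intro y hy hyx
      rw [h.2 _ _ hx hy]
      simp only [Equiv.apply_symm_apply]
      apply hM
      · intro h3
        apply hyx
        rw [← h3]; simp
      · exact h.ne hy
    have hxu : σ.symm u ≠ u := by
      intro h3
      rw [h3] at hx2
      have : (Fintype.card V : ℤ) - 1 - ({e} : Finset V).card ≤ dg G u := by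
        apply le_dg_miss
        intro y hy h4
        by_contra h5
        exact h4 (hx2 y (by simpa using h5) hy)
      simp at this
      omega
    have hxb := hN _ ((hx2 u heu.symm hxu.symm).symm)
    rw [hxb] at hx hx2
    exact ⟨hx, fun y h1 h2 => hx2 y h2 h1⟩
  obtain ⟨hbe, hb⟩ := hbe
  -- card b
  have heb : ∀ y, H.Adj e y → y = b := by
    obtain ⟨σ, h⟩ := hc b hbu
    have hiso : ∀ y, y ≠ b → ¬ H.Adj (σ u) y := by
      intro y hy h1
      have h4 : σ.symm y ≠ b := h.symm.ne hy
      have := (h.2 u (σ.symm y) hbu.symm h4).2 (by simpa using h1)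
      exact h4 (hN _ this)
    have h1 : σ u = e := by
      by_contra h1
      have h2 : σ u ≠ u := by
        intro h2
        rw [h2] at hiso
        obtain ⟨v, hv⟩ := exists_notMem ({u, b, e} : Finset V)
          (lt_of_le_of_lt Finset.card_le_three (by omega))
        simp at hv
        exact hiso v hv.2.1 (hM v hv.1 hv.2.2)
      exact hiso u hbu.symm (hM _ h2 h1).symm
    rw [h1] at hiso
    intro y hy
    by_contra h3
    exact hiso y h3 hy
  -- two generic vertices
  have htwo : ∃ v1 v2, v1 ≠ v2 ∧ v1 ∉ ({u, b, e} : Finset V) ∧ v2 ∉ ({u, b, e} : Finset V) := by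
    obtain ⟨v1, hv1⟩ := exists_notMem ({u, b, e} : Finset V)
          (lt_of_le_of_lt Finset.card_le_three (by omega))
    obtain ⟨v2, hv2⟩ := exists_notMem ({v1, u, b, e} : Finset V)
          (lt_of_le_of_lt Finset.card_le_four (by omega))
    refine ⟨v1, v2, ?_, hv1, ?_⟩
    · intro h; apply hv2; simp [h]
    · intro h; apply hv2; exact Finset.mem_insert_of_mem h
  obtain ⟨v1, v2, hv12, hv1, hv2⟩ := htwo
  have hnGbe : ¬ G.Adj b e := by
    intro hGbe
    have hball : ∀ y, y ≠ b → G.Adj b y := by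
      intro y hy
      by_cases h : y = e
      · rw [h]; exact hGbe
      · exact hb y hy h
    have key : ∀ v, v ∉ ({u, b, e} : Finset V) → ∀ y, y ≠ v → y ≠ b → H.Adj b y := by
      intro v hv
      simp at hv
      obtain ⟨hvu, hvb, hve⟩ := hv
      obtain ⟨σ, h⟩ := hc v hvu
      have hq : ∀ y, y ≠ v → y ≠ σ b → H.Adj (σ b) y := by
        intro y hy hyx
        have h4 : σ.symm y ≠ v := h.symm.ne hy
        have := (h.2 b (σ.symm y) (Ne.symm hvb) h4).1 (hball _ (by
          intro h5; apply hyx; rw [← h5]; simp))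
        simpa using this
      have h1 : σ b ≠ e := by
        intro h1
        rw [h1] at hq
        exact hue (hq u (Ne.symm hvu) heu.symm).symm
      have h2 : σ b = b := heb _ (hq e (Ne.symm hve) h1.symm).symm
      rwa [h2] at hq
    have hHb : ∀ y, y ≠ b → H.Adj b y := by
      intro y hy
      by_cases h : y = v1
      · exact key v2 hv2 y (by rw [h]; exact hv12) hy
      · exact key v1 hv1 y h hy
    have := le_dg_miss H b ∅ (fun y h1 h2 => absurd (hHb y h1) h2)
    have h3 := hd b hbu
    have h4 := dg_le G b
    simp at this
    linarith
  have hHeb : H.Adj e b := by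
    by_contra hHeb
    have heiso : ∀ y, ¬ H.Adj e y := by
      intro y hy
      have := heb y hy
      rw [this] at hy
      exact hHeb hy
    have key : ∀ v, v ∉ ({u, b, e} : Finset V) → ∀ y, y ≠ v → ¬ G.Adj e y := by
      intro v hv
      simp at hv
      obtain ⟨hvu, hvb, hve⟩ := hv
      obtain ⟨σ, h⟩ := hc v hvu
      have hx : σ.symm e ≠ v := h.symm.ne (Ne.symm hve)
      have hq : ∀ y, y ≠ v → ¬ G.Adj (σ.symm e) y := by
        intro y hy h1
        have := (h.2 _ _ hx hy).1 h1
        simp at this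
        exact heiso _ this
      have h1 : σ.symm e ≠ b := by
        intro h1
        rw [h1] at hq
        exact hq u (Ne.symm hvu) hub.symm
      have h2 : σ.symm e = e := by
        by_contra h2
        exact hq b (Ne.symm hvb) (hb _ h1 h2).symm
      rwa [h2] at hq
    have hGe : ∀ y, ¬ G.Adj e y := by
      intro y
      by_cases h : y = v1
      · exact key v2 hv2 y (by rw [h]; exact hv12)
      · exact key v1 hv1 y h
    have := dg_le_nbr G e ∅ (fun y h => absurd h (hGe y))
    have h3 := hd e heu
    have h4 := dg_nonneg H e
    simp at this
    linarith
  have hdHe : dg H e = 1 := by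
    have h1 := dg_le_nbr H e {b} (fun y h => by simpa using heb y h)
    have h2 := le_dg H e {b} (fun y h => by simp at h; rw [h]; exact hHeb)
    simp at h1 h2
    linarith
  have hdGe : dg G e = 2 := by rw [hd e heu, hdHe]; norm_num
  have hdGb : dg G b = (Fintype.card V : ℤ) - 2 := by
    have h1 := le_dg_miss G b {e} (fun y h1 h2 => by
      by_contra h3; exact h2 (hb y h1 (by simpa using h3)))
    have h2 := dg_le_miss G b {e} (fun y hy => by
      simp at hy; rw [hy]; exact ⟨hbe.symm, hnGbe⟩)
    simp at h1 h2
    linarith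
  have hdHb : dg H b = (Fintype.card V : ℤ) - 3 := by
    have := hd b hbu
    linarith
  -- g
  have hg : ∃ g, g ≠ u ∧ g ≠ e ∧ g ≠ b ∧ H.Adj g u ∧ ∀ y, H.Adj g y → y = u := by
    obtain ⟨σ, h⟩ := hc e heu
    have hs := h.symm
    have hsb : σ b = u := by
      have hx : σ.symm u ≠ e := hs.ne heu.symm
      have hx2 : ∀ y, y ≠ e → y ≠ σ.symm u → G.Adj (σ.symm u) y := by
        intro y hy hyx
        rw [h.2 _ _ hx hy]
        simp only [Equiv.apply_symm_apply]
        apply hM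
        · intro h3
          apply hyx
          rw [← h3]; simp
        · exact h.ne hy
      have hxu : σ.symm u ≠ u := by
        intro h3
        rw [h3] at hx2
        have : (Fintype.card V : ℤ) - 1 - ({e} : Finset V).card ≤ dg G u := by
          apply le_dg_miss
          intro y hy h4
          by_contra h5
          exact h4 (hx2 y (by simpa using h5) hy)
        simp at this
        omega
      have hxb := hN _ ((hx2 u heu.symm hxu.symm).symm)
      rw [← hxb]; simp
    have hgu : σ u ≠ u := by
      intro h1
      exact hbu (σ.injective (hsb.trans h1.symm))
    have hge : σ u ≠ e := h.ne heu.symm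
    have hgadj : H.Adj (σ u) u := (hM _ hgu hge).symm
    have hgn : ∀ y, y ≠ e → H.Adj (σ u) y → y = u := by
      intro y hy h1
      have h4 : σ.symm y ≠ e := h.symm.ne hy
      have := (h.2 u (σ.symm y) heu.symm h4).2 (by simpa using h1)
      have := hN _ this
      rw [← hsb, ← this]; simp
    have hgb : σ u ≠ b := by
      intro h1
      rw [h1] at hgn
      have := dg_le_nbr H b {u, e} (fun y h => by
        simp
        by_cases h3 : y = e
        · exact Or.inr h3
        · exact Or.inl (hgn y h3 h))
      have h3 : (({u, e} : Finset V).card : ℤ) ≤ 2 := by exact_mod_cast Finset.card_le_two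
      linarith
    refine ⟨σ u, hgu, hge, hgb, hgadj, fun y hy => ?_⟩
    apply hgn y _ hy
    rintro rfl
    exact hgb (heb _ hy.symm)
  obtain ⟨g, hgu, hge, hgb, hgadj, hgN⟩ := hg
  have hdHg : dg H g = 1 := by
    have h1 := dg_le_nbr H g {u} (fun y h => by simpa using hgN y h)
    have h2 := le_dg H g {u} (fun y h => by simp at h; rw [h]; exact hgadj)
    simp at h1 h2
    linarith
  have hdGg : dg G g = 2 := by rw [hd g hgu, hdHg]; norm_num
  -- x
  have hx : ∃ x, x ≠ u ∧ x ≠ b ∧ x ≠ e ∧ ∀ y, y ≠ x → y ≠ u → G.Adj x y := by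
    obtain ⟨σ, h⟩ := hc b hbu
    have hs := h.symm
    have hxb : σ.symm u ≠ b := hs.ne hbu.symm
    have hx2 : ∀ y, y ≠ b → y ≠ σ.symm u → y ≠ σ.symm e → G.Adj (σ.symm u) y := by
      intro y hy hyx hye
      rw [h.2 _ _ hxb hy]
      simp only [Equiv.apply_symm_apply]
      apply hM
      · intro h3
        apply hyx
        rw [← h3]; simp
      · intro h3
        apply hye
        rw [← h3]; simp
    have hdx : (Fintype.card V : ℤ) - 3 ≤ dg G (σ.symm u) := by
      have := le_dg_miss G (σ.symm u) {b, σ.symm e} (fun y h1 h2 => by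
        simp
        by_contra h3
        push Not at h3
        exact h2 (hx2 y h3.1 h1 h3.2))
      have h3 : (({b, σ.symm e} : Finset V).card : ℤ) ≤ 2 := by exact_mod_cast Finset.card_le_two
      linarith
    have hxu : σ.symm u ≠ u := by
      intro h1
      rw [h1] at hdx
      omega
    have hxe : σ.symm u ≠ e := by
      intro h1
      rw [h1] at hdx
      omega
    have heu' : σ.symm e = u := by
      by_contra h1
      have := hN _ (hx2 u hbu.symm hxu.symm (Ne.symm h1)).symm
      exact hxb this
    rw [heu'] at hx2
    refine ⟨σ.symm u, hxu, hxb, hxe, fun y h1 h2 => ?_⟩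
    by_cases h3 : y = b
    · rw [h3]
      exact (hb _ hxb hxe).symm
    · exact hx2 y h3 h1 h2
  obtain ⟨x, hxu, hxb, hxe, hx⟩ := hx
  have hxu' : ¬ G.Adj x u := fun h => hxb (hN _ h.symm)
  have hdGx : dg G x = (Fintype.card V : ℤ) - 2 := by
    have h1 := le_dg_miss G x {u} (fun y h1 h2 => by
      by_contra h3; exact h2 (hx y h1 (by simpa using h3)))
    have h2 := dg_le_miss G x {u} (fun y hy => by
      simp at hy; rw [hy]; exact ⟨hxu.symm, hxu'⟩)
    simp at h1 h2
    linarith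
  have hdHx : dg H x = (Fintype.card V : ℤ) - 3 := by
    have := hd x hxu
    linarith
  have hxg : x ≠ g := by
    rintro rfl
    omega
  have hxH : ∀ y, y ≠ x → y ∉ ({e, g} : Finset V) → H.Adj x y := by
    apply nn_eq
    · intro y hy
      simp at hy
      rcases hy with rfl | rfl
      · exact ⟨hxe.symm, fun h => hxb (heb _ h.symm)⟩
      · exact ⟨hxg.symm, fun h => hxu (hgN _ h.symm)⟩
    · rw [Finset.card_pair hge.symm, hdHx]
      push_cast; linarith
  obtain ⟨y', hy'⟩ := dg_miss_two hdHb hgb (fun h => hbu (hgN _ h.symm))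
  have hgGN : ∀ y, G.Adj g y → y ∈ ({x, b} : Finset V) := by
    apply nbr_eq
    · intro y hy
      simp at hy
      rcases hy with rfl | rfl
      · exact (hx g hxg.symm hgu).symm
      · exact (hb g hgb hge).symm
    · rw [Finset.card_pair hxb, hdGg]; norm_num
  obtain ⟨v, hv⟩ := exists_notMem ({u, e, b, x, g, y'} : Finset V)
    (lt_of_le_of_lt Finset.card_le_six (by omega))
  simp at hv
  obtain ⟨hvu, hve, hvb, hvx, hvg, hvy⟩ := hv
  obtain ⟨σ, h⟩ := hc v hvu
  have hb1 : adjZ G b v = 1 := adjZ_pos (hb v hvb hve)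
  have hx1 : adjZ G x v = 1 := adjZ_pos (hx v hvx hvu)
  have hq : ∃ q, q ≠ u ∧ q ≠ v ∧ dg H q - adjZ H q v = (Fintype.card V : ℤ) - 3 := by
    by_cases h1 : σ b = u
    · refine ⟨σ x, fun h2 => hxb (σ.injective (h2.trans h1.symm)), h.ne (Ne.symm hvx), ?_⟩
      rw [← h.cdeg (Ne.symm hvx), hdGx, hx1]; ring
    · refine ⟨σ b, h1, h.ne (Ne.symm hvb), ?_⟩
      rw [← h.cdeg (Ne.symm hvb), hdGb, hb1]; ring
  obtain ⟨q, hqu, hqv, hq⟩ := hq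
  have hnn := adjZ_nonneg H q v
  have hqe : q ≠ e := by rintro rfl; omega
  have hqg : q ≠ g := by rintro rfl; omega
  have hqb : q ≠ b := by
    rintro rfl
    rw [adjZ_pos (hy' v hvb hvg hvy)] at hq
    omega
  have hqx : q ≠ x := by
    rintro rfl
    rw [adjZ_pos (hxH v hvx (by simp [hve, hvg]))] at hq
    omega
  have h1 := dg_le_miss G q {u, g} (fun y hy => by
    simp at hy
    rcases hy with rfl | rfl
    · exact ⟨hqu.symm, fun h => hqb (hN _ h.symm)⟩
    · refine ⟨hqg.symm, fun h => ?_⟩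
      have := hgGN _ h.symm
      simp at this
      rcases this with h | h
      · exact hqx h
      · exact hqb h)
  rw [Finset.card_pair hgu.symm] at h1
  have h2 := hd q hqu
  push_cast at h1
  linarith

lemma deg_eq_aux {G H : SimpleGraph V} {u : V} (hc : ∀ v, v ≠ u → CI G H v)
    (hn : 7 ≤ Fintype.card V) (hd : ∀ v, v ≠ u → dg G v = dg H v + 1)
    (hu : dg H u = dg G u + ((Fintype.card V : ℤ) - 3)) : False := by
  have h1 := dg_nonneg G u
  have h2 := dg_le H u
  have h3 : dg G u = 0 ∨ dg G u = 1 ∨ dg G u = 2 := by omega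
  rcases h3 with h3 | h3 | h3
  · refine edge_two (G := Hᶜ) (H := Gᶜ) (u := u) (fun v hv => (hc v hv).symm.compl) hn ?_ ?_ ?_
    · intro v hv
      rw [dg_compl, dg_compl, hd v hv]; ring
    · rw [dg_compl, hu, h3]; ring
    · rw [dg_compl, h3]; ring
  · exact edge_one hc hn hd h3 (by rw [hu, h3]; ring)
  · exact edge_two hc hn hd h3 (by rw [hu, h3]; ring)

theorem deg_eq {G H : SimpleGraph V} {u : V} (hc : ∀ v, v ≠ u → CI G H v)
    (hn : 7 ≤ Fintype.card V) : ∀ v, dg G v = dg H v := by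
  obtain ⟨C, h1, h2⟩ := deg_rel hc (by omega)
  have a1 := dg_nonneg G u
  have a2 := dg_le H u
  have a3 := dg_nonneg H u
  have a4 := dg_le G u
  have hn' : (7 : ℤ) ≤ Fintype.card V := by exact_mod_cast hn
  have b1 : C < 2 := by
    by_contra h
    push Not at h
    nlinarith
  have b2 : -2 < C := by
    by_contra h
    push Not at h
    nlinarith
  have b3 : C = 0 ∨ C = 1 ∨ C = -1 := by omega
  rcases b3 with rfl | rfl | rfl
  · intro v
    by_cases hv : v = u
    · subst hv; linarith
    · rw [h1 v hv]; ring
  · exact (deg_eq_aux hc hn h1 (by rw [h2]; ring)).elim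
  · refine (deg_eq_aux (G := H) (H := G) (fun v hv => (hc v hv).symm) hn ?_ ?_).elim
    · intro v hv; rw [h1 v hv]; ring
    · rw [h2]; ring

lemma clique_map {G H : SimpleGraph V} {σ : Equiv.Perm V} {s : Finset V} (r : ℕ)
    (h : ∀ x ∈ s, ∀ y ∈ s, (G.Adj x y ↔ H.Adj (σ x) (σ y))) :
    G.IsNClique r s ↔ H.IsNClique r (Equiv.finsetCongr σ s) := by
  rw [SimpleGraph.isNClique_iff, SimpleGraph.isNClique_iff, SimpleGraph.isClique_iff,
    SimpleGraph.isClique_iff]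
  simp only [Equiv.finsetCongr_apply, Finset.card_map, Finset.coe_map, Set.Pairwise]
  refine and_congr_left (fun _ => ⟨?_, ?_⟩)
  · rintro h1 _ ⟨x, hx, rfl⟩ _ ⟨y, hy, rfl⟩ hxy
    exact (h x hx y hy).1 (h1 hx hy (fun h2 => hxy (by rw [h2])))
  · intro h1 x hx y hy hxy
    exact (h x hx y hy).2 (h1 ⟨x, hx, rfl⟩ ⟨y, hy, rfl⟩ (fun h2 => hxy (σ.injective h2)))

lemma KK_iso {G H : SimpleGraph V} (σ : Equiv.Perm V)
    (h : ∀ x y, (G.Adj x y ↔ H.Adj (σ x) (σ y))) (r : ℕ) : KK G r = KK H r := by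
  unfold KK
  rw [← Equiv.sum_comp (Equiv.finsetCongr σ) (fun s => if H.IsNClique r s then (1 : ℤ) else 0)]
  refine Finset.sum_congr rfl (fun s _ => ?_)
  simp only [clique_map (s := s) r (fun x _ y _ => h x y)]

lemma CIs.clique {G H : SimpleGraph V} {v : V} {σ : Equiv.Perm V} (h : CIs G H v σ)
    (r : ℕ) {s : Finset V} (hs : v ∉ s) :
    G.IsNClique r s ↔ H.IsNClique r (Equiv.finsetCongr σ s) :=
  clique_map r (fun x hx y hy => h.2 x y (fun e => hs (e ▸ hx)) (fun e => hs (e ▸ hy)))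

lemma CIs.kelly {G H : SimpleGraph V} {v : V} {σ : Equiv.Perm V} (h : CIs G H v σ) (r : ℕ) :
    KK G r - DD G r v = KK H r - DD H r v := by
  have key : ∀ G : SimpleGraph V, KK G r - DD G r v =
      ∑ s : Finset V, if (G.IsNClique r s ∧ v ∉ s) then 1 else 0 := by
    intro G
    unfold KK DD
    rw [← Finset.sum_sub_distrib]
    refine Finset.sum_congr rfl (fun s _ => ?_)
    by_cases h1 : G.IsNClique r s <;> by_cases h2 : v ∈ s <;> simp [h1, h2]
  rw [key G, key H, ← Equiv.sum_comp (Equiv.finsetCongr σ)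
    (fun s => if (H.IsNClique r s ∧ v ∉ s) then (1 : ℤ) else 0)]
  refine Finset.sum_congr rfl (fun s _ => ?_)
  have hv : v ∈ s ↔ v ∈ Equiv.finsetCongr σ s := by
    simp only [Equiv.finsetCongr_apply, Finset.mem_map_equiv]
    rw [h.symm.1]
  by_cases hs : v ∈ s
  · rw [if_neg (fun h => h.2 hs), if_neg (fun h => h.2 (hv.1 hs))]
  · have := h.clique r hs
    simp only [← this, ← hv]

lemma CIs.DD_nn {G H : SimpleGraph V} {v x : V} {σ : Equiv.Perm V} (h : CIs G H v σ) (r : ℕ)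
    (hx : x ≠ v) (h1 : ¬ G.Adj x v) (h2 : ¬ H.Adj (σ x) v) : DD G r x = DD H r (σ x) := by
  unfold DD
  rw [← Equiv.sum_comp (Equiv.finsetCongr σ)
    (fun s => if (H.IsNClique r s ∧ σ x ∈ s) then (1 : ℤ) else 0)]
  refine Finset.sum_congr rfl (fun s _ => ?_)
  have hv : v ∈ s ↔ v ∈ Equiv.finsetCongr σ s := by
    simp only [Equiv.finsetCongr_apply, Finset.mem_map_equiv]
    rw [h.symm.1]
  have hxs : x ∈ s ↔ σ x ∈ Equiv.finsetCongr σ s := by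
    simp
  by_cases hs : v ∈ s
  · rw [if_neg, if_neg]
    · rintro ⟨a, b⟩
      exact h2 (a.isClique b (hv.1 hs) (h.ne hx))
    · rintro ⟨a, b⟩
      exact h1 (a.isClique b hs hx)
  · have := h.clique r hs
    simp only [← this, ← hxs]

lemma sum_DD (G : SimpleGraph V) (r : ℕ) : ∑ v, DD G r v = r * KK G r := by
  unfold DD KK
  rw [Finset.sum_comm, Finset.mul_sum]
  refine Finset.sum_congr rfl (fun s _ => ?_)
  by_cases h : G.IsNClique r s
  · simp [h, h.card_eq]
  · simp [h]

lemma DD_rel {G H : SimpleGraph V} {u : V} (hc : ∀ v, v ≠ u → CI G H v) (r : ℕ) :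
    (∀ v, v ≠ u → DD G r v = DD H r v + (KK G r - KK H r)) ∧
      DD H r u = DD G r u + ((Fintype.card V : ℤ) - 1 - r) * (KK G r - KK H r) := by
  have h1 : ∀ v, v ≠ u → DD G r v = DD H r v + (KK G r - KK H r) := by
    intro v hv
    obtain ⟨σ, h⟩ := hc v hv
    have := h.kelly r
    linarith
  refine ⟨h1, ?_⟩
  have e1 : ∀ v, DD G r v = DD H r v + (KK G r - KK H r) +
      (if v = u then DD G r u - DD H r u - (KK G r - KK H r) else 0) := by
    intro v
    split_ifs with h
    · subst h; ring
    · rw [h1 v h]; ring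
  have e2 : ∑ x, DD G r x = ∑ x, (DD H r x + (KK G r - KK H r) +
      (if x = u then DD G r u - DD H r u - (KK G r - KK H r) else 0)) :=
    Finset.sum_congr rfl (fun v _ => e1 v)
  rw [Finset.sum_add_distrib, Finset.sum_add_distrib, sum_DD, sum_DD] at e2
  simp at e2
  linarith

lemma DD_succ (G : SimpleGraph V) (r : ℕ) (x : V) : DD G (r + 1) x =
    ∑ t : Finset V, if (G.IsNClique r t ∧ ∀ y ∈ t, G.Adj x y) then 1 else 0 := by
  unfold DD
  rw [Finset.sum_boole, Finset.sum_boole]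
  congr 1
  refine Finset.card_nbij' (fun s => s.erase x) (fun t => insert x t) ?_ ?_ ?_ ?_
  · intro s hs
    simp at hs ⊢
    refine ⟨?_, ?_⟩
    · rw [SimpleGraph.isNClique_iff]
      refine ⟨hs.1.isClique.subset (by simp), ?_⟩
      rw [Finset.card_erase_of_mem hs.2, hs.1.card_eq]; rfl
    · intro y hy hys
      exact hs.1.isClique hs.2 hys (Ne.symm hy)
  · intro t ht
    simp at ht ⊢
    exact ht.1.insert ht.2
  · intro s hs
    simp at hs
    exact Finset.insert_erase hs.2
  · intro t ht
    simp at ht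
    exact Finset.erase_insert (fun h => G.loopless.irrefl _ (ht.2 x h))

lemma DD_formula (G : SimpleGraph V) (r : ℕ) (x : V)
    (h : (Fintype.card V : ℤ) - 2 ≤ dg G x) :
    DD G (r + 1) x + DD G r x +
      ∑ v, (if x ≠ v ∧ ¬ G.Adj x v then DD G r v else 0) = KK G r := by
  rw [DD_succ]
  have h0 : ∑ v, (if x ≠ v ∧ ¬ G.Adj x v then DD G r v else 0) =
      ∑ s : Finset V, ∑ v, (if x ≠ v ∧ ¬ G.Adj x v ∧ G.IsNClique r s ∧ v ∈ s then 1 else 0) := by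
    rw [Finset.sum_comm]
    refine Finset.sum_congr rfl (fun v _ => ?_)
    unfold DD
    by_cases h1 : x ≠ v ∧ ¬ G.Adj x v
    · simp [h1.1, h1.2]
    · rw [if_neg h1]
      symm
      apply Finset.sum_eq_zero
      intro s _
      rw [if_neg]
      tauto
  rw [h0]
  unfold DD KK
  rw [← Finset.sum_add_distrib, ← Finset.sum_add_distrib]
  refine Finset.sum_congr rfl (fun s _ => ?_)
  by_cases hs : G.IsNClique r s
  swap
  · simp [hs]
  simp only [hs, true_and, if_true]
  by_cases hxs : x ∈ s
  · have h1 : ¬ ∀ y ∈ s, G.Adj x y := fun h => G.loopless.irrefl _ (h x hxs)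
    have h2 : ∑ v, (if x ≠ v ∧ ¬ G.Adj x v ∧ v ∈ s then (1 : ℤ) else 0) = 0 := by
      apply Finset.sum_eq_zero
      intro v _
      rw [if_neg]
      rintro ⟨a, b, c⟩
      exact b (hs.isClique hxs c a)
    rw [h2]
    simp [h1, hxs]
  · by_cases h1 : ∀ y ∈ s, G.Adj x y
    · have h2 : ∑ v, (if x ≠ v ∧ ¬ G.Adj x v ∧ v ∈ s then (1 : ℤ) else 0) = 0 := by
        apply Finset.sum_eq_zero
        intro v _
        rw [if_neg]
        rintro ⟨a, b, c⟩
        exact b (h1 v c)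
      rw [h2, if_pos h1]
      simp [hxs]
    · rw [if_neg h1]
      push Not at h1
      obtain ⟨z, hz, hxz⟩ := h1
      have hzx : z ≠ x := fun e => hxs (e ▸ hz)
      have h3 := nn_eq G x {z} (fun y hy => by simp at hy; rw [hy]; exact ⟨hzx, hxz⟩)
        (by simp; linarith)
      have h2 : ∑ v, (if x ≠ v ∧ ¬ G.Adj x v ∧ v ∈ s then (1 : ℤ) else 0) =
          ∑ v, (if v = z then (1 : ℤ) else 0) := by
        refine Finset.sum_congr rfl (fun v _ => ?_)
        by_cases hv : v = z
        · subst hv; simp [Ne.symm hzx, hxz, hz]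
        · rw [if_neg hv, if_neg]
          rintro ⟨a, b, c⟩
          exact b (h3 v (Ne.symm a) (by simpa using hv))
      rw [h2]
      simp [hxs]

/-- max degree vertices not in the closed neighbourhood of `v` -/
noncomputable def MM (G : SimpleGraph V) (d : ℤ) (v : V) : Finset V :=
  Finset.univ.filter (fun x => dg G x = d ∧ x ≠ v ∧ ¬ G.Adj x v)

/-- max degree vertices -/
noncomputable def LL (G : SimpleGraph V) (d : ℤ) : Finset V :=
  Finset.univ.filter (fun x => dg G x = d)

lemma mem_MM_iff {G : SimpleGraph V} {d : ℤ} (hd : ∀ v, dg G v ≤ d) {v x : V} (hx : x ≠ v) :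
    x ∈ MM G d v ↔ dg G x - adjZ G x v = d := by
  simp only [MM, Finset.mem_filter, Finset.mem_univ, true_and]
  by_cases h : G.Adj x v
  · simp only [h, not_true, and_false, false_iff, adjZ_pos h]
    have := hd x
    omega
  · simp [h, hx, adjZ_neg h]

lemma CIs.MM_iff {G H : SimpleGraph V} {v : V} {σ : Equiv.Perm V} (h : CIs G H v σ) {d : ℤ}
    (hd : ∀ v, dg G v ≤ d) (hd' : ∀ v, dg H v ≤ d) (x : V) :
    x ∈ MM G d v ↔ σ x ∈ MM H d v := by
  by_cases hx : x = v
  · subst hx; simp [MM, h.1]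
  · rw [mem_MM_iff hd hx, mem_MM_iff hd' (h.ne hx), h.cdeg hx]

lemma CIs.MM_DD {G H : SimpleGraph V} {v : V} {σ : Equiv.Perm V} (h : CIs G H v σ) {d : ℤ}
    (hd : ∀ v, dg G v ≤ d) (hd' : ∀ v, dg H v ≤ d) (r : ℕ) (x : V) (hx : x ∈ MM G d v) :
    DD G r x = DD H r (σ x) := by
  have h2 := (h.MM_iff hd hd' x).1 hx
  simp only [MM, Finset.mem_filter, Finset.mem_univ, true_and] at hx h2
  exact h.DD_nn r hx.2.1 hx.2.2 h2.2.2

lemma MM_sum_eq {G H : SimpleGraph V} {v : V} (h : CI G H v) {d : ℤ}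
    (hd : ∀ v, dg G v ≤ d) (hd' : ∀ v, dg H v ≤ d) (r : ℕ) (g : ℤ → ℤ) :
    ∑ x ∈ MM G d v, g (DD G r x) = ∑ x ∈ MM H d v, g (DD H r x) := by
  obtain ⟨σ, h⟩ := h
  refine Finset.sum_equiv σ (fun x => h.MM_iff hd hd' x) (fun x hx => ?_)
  rw [h.MM_DD hd hd' r x hx]

lemma MM_sum (G : SimpleGraph V) (d : ℤ) (v : V) (F : V → ℤ) :
    ∑ x ∈ MM G d v, F x = ∑ x ∈ LL G d, (if x ≠ v ∧ ¬ G.Adj x v then F x else 0) := by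
  unfold MM LL
  rw [Finset.sum_filter, Finset.sum_filter]
  refine Finset.sum_congr rfl (fun x _ => ?_)
  by_cases h1 : dg G x = d <;> simp [h1]

lemma MM_total (G : SimpleGraph V) (d : ℤ) (F W : V → ℤ) :
    ∑ v, W v * ∑ x ∈ MM G d v, F x =
      ∑ x ∈ LL G d, F x * ∑ v, (if x ≠ v ∧ ¬ G.Adj x v then W v else 0) := by
  simp only [MM_sum, Finset.mul_sum]
  rw [Finset.sum_comm]
  refine Finset.sum_congr rfl (fun x _ => Finset.sum_congr rfl (fun v _ => ?_))
  split_ifs <;> ring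

lemma nn_sum (G : SimpleGraph V) (x : V) :
    ∑ v, (if x ≠ v ∧ ¬ G.Adj x v then (1 : ℤ) else 0) = (Fintype.card V : ℤ) - 1 - dg G x := by
  rw [dg_nn, Finset.sum_boole]
  simp only [ne_comm]
  ring

lemma MM_total_one (G : SimpleGraph V) (d : ℤ) (F : V → ℤ) :
    ∑ v, ∑ x ∈ MM G d v, F x = ((Fintype.card V : ℤ) - 1 - d) * ∑ x ∈ LL G d, F x := by
  have := MM_total G d F (fun _ => 1)
  simp only [one_mul, nn_sum] at this
  rw [this, Finset.mul_sum]
  refine Finset.sum_congr rfl (fun x hx => ?_)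
  simp [LL] at hx
  rw [hx]; ring

/-- sum over pairs inside L -/
lemma MM_total_L (G : SimpleGraph V) (d : ℤ) (F : V → ℤ) :
    ∑ v ∈ LL G d, ∑ x ∈ MM G d v, F x = ∑ x ∈ LL G d, F x * (MM G d x).card := by
  have := MM_total G d F (fun v => if v ∈ LL G d then 1 else 0)
  simp only [ite_mul, one_mul, zero_mul, Finset.sum_ite_mem, Finset.univ_inter] at this
  rw [this]
  refine Finset.sum_congr rfl (fun x hx => ?_)
  congr 1
  rw [Finset.card_eq_sum_ones]
  push_cast
  rw [MM_sum, ← Finset.sum_filter_add_sum_filter_not Finset.univ (fun v => v ∈ LL G d)]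
  have h2 : ∑ v with v ∉ LL G d, (if x ≠ v ∧ ¬ G.Adj x v then
      (if v ∈ LL G d then (1 : ℤ) else 0) else 0) = 0 := by
    apply Finset.sum_eq_zero
    intro v hv
    simp at hv
    simp [hv]
  rw [h2]
  simp only [add_zero, Finset.filter_univ_mem]
  refine Finset.sum_congr rfl (fun v hv => ?_)
  simp only [hv, if_true, ne_comm, G.adj_comm]

/-- difference at `u` -/
lemma MM_diff {G H : SimpleGraph V} {u : V} (hc : ∀ v, v ≠ u → CI G H v) {d : ℤ}
    (hdeg : ∀ v, dg G v = dg H v)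
    (hd : ∀ v, dg G v ≤ d) (r : ℕ) (g : ℤ → ℤ) :
    ∑ x ∈ MM G d u, g (DD G r x) - ∑ x ∈ MM H d u, g (DD H r x) =
      ((Fintype.card V : ℤ) - 1 - d) * ∑ x ∈ LL G d, (g (DD G r x) - g (DD H r x)) := by
  have hd' : ∀ v, dg H v ≤ d := fun v => hdeg v ▸ hd v
  have hL : LL G d = LL H d := by
    unfold LL; simp only [hdeg]
  have h1 := MM_total_one G d (fun x => g (DD G r x))
  have h2 := MM_total_one H d (fun x => g (DD H r x))
  rw [← hL] at h2
  have h3 : ∑ v, (∑ x ∈ MM G d v, g (DD G r x) - ∑ x ∈ MM H d v, g (DD H r x)) =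
      ∑ x ∈ MM G d u, g (DD G r x) - ∑ x ∈ MM H d u, g (DD H r x) := by
    apply Finset.sum_eq_single
    · intro v _ hv
      rw [MM_sum_eq (hc v hv) hd hd' r g, sub_self]
    · simp
  rw [← h3, Finset.sum_sub_distrib, h1, h2, Finset.sum_sub_distrib]
  ring

lemma MM_card_eq {G H : SimpleGraph V} {u : V} (hc : ∀ v, v ≠ u → CI G H v) {d : ℤ}
    (hdeg : ∀ v, dg G v = dg H v)
    (hd : ∀ v, dg G v ≤ d) (v : V) : (MM G d v).card = (MM H d v).card := by
  have hd' : ∀ v, dg H v ≤ d := fun v => hdeg v ▸ hd v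
  by_cases hv : v = u
  · subst hv
    have := MM_diff hc hdeg hd 0 (fun _ => 1)
    simp at this
    omega
  · have := MM_sum_eq (hc v hv) hd hd' 0 (fun _ => 1)
    simp at this
    omega

lemma out_t {G H : SimpleGraph V} {u : V} (hc : ∀ v, v ≠ u → CI G H v) {d : ℤ}
    (hdeg : ∀ v, dg G v = dg H v) (hd : ∀ v, dg G v ≤ d) (hL : (LL G d).Nonempty)
    (hu : u ∉ LL G d) (r : ℕ) (hlt : KK H r < KK G r) : (Fintype.card V : ℤ) - 2 ≤ d := by
  have hd' : ∀ v, dg H v ≤ d := fun v => hdeg v ▸ hd v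
  obtain ⟨y, hy, hmin⟩ := Finset.exists_min_image (LL G d) (fun x => DD H r x) hL
  have hyd : dg H y = d := by
    simp [LL] at hy; rw [← hdeg, hy]
  have hall : ∀ v, v ≠ y → ¬ H.Adj y v → v ∈ ({u} : Finset V) := by
    intro v hvy hadj
    by_contra hvu
    simp at hvu
    obtain ⟨σ, h⟩ := hc v hvu
    have hyM : y ∈ MM H d v := by simp [MM, hyd, hadj, Ne.symm hvy]
    have h1 : σ.symm y ∈ MM G d v := by
      rw [h.MM_iff hd hd']; simpa using hyM
    have h2 := h.MM_DD hd hd' r _ h1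
    simp only [Equiv.apply_symm_apply] at h2
    have h3 : σ.symm y ∈ LL G d := by
      simp [MM] at h1; simp [LL, h1.1]
    have h4 : σ.symm y ≠ u := fun e => hu (e ▸ h3)
    have h5 := (DD_rel hc r).1 _ h4
    have h6 := hmin _ h3
    linarith
  have := le_dg_miss H y {u} hall
  simp at this
  linarith

lemma out_case {G H : SimpleGraph V} {u : V} (hc : ∀ v, v ≠ u → CI G H v) {d : ℤ}
    (hdeg : ∀ v, dg G v = dg H v) (hd : ∀ v, dg G v ≤ d) (hL : (LL G d).Nonempty)
    (hu : u ∉ LL G d) (r : ℕ) : KK G r = KK H r := by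
  have hLL : LL G d = LL H d := by
    unfold LL; simp only [hdeg]
  induction r with
  | zero =>
    unfold KK
    refine Finset.sum_congr rfl (fun s _ => ?_)
    simp [SimpleGraph.isNClique_zero]
  | succ r ih =>
    by_contra hne
    have ht : (Fintype.card V : ℤ) - 2 ≤ d := by
      rcases lt_or_gt_of_ne hne with h | h
      · exact out_t (fun v hv => (hc v hv).symm) (fun v => (hdeg v).symm)
          (fun v => hdeg v ▸ hd v) (hLL ▸ hL) (hLL ▸ hu) (r + 1) h
      · exact out_t hc hdeg hd hL hu (r + 1) h
    have hD : ∀ v, DD G r v = DD H r v := by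
      intro v
      have := DD_rel hc r
      rw [ih] at this
      by_cases hv : v = u
      · subst hv; linarith [this.2]
      · linarith [this.1 v hv]
    have key : ∀ G : SimpleGraph V, ∑ x ∈ LL G d, DD G (r + 1) x =
        ∑ x ∈ LL G d, (KK G r - DD G r x) - ∑ v, DD G r v * (MM G d v).card := by
      intro G
      have h1 := MM_total G d (fun _ => 1) (fun v => DD G r v)
      simp only [Finset.sum_const, nsmul_eq_mul, mul_one, one_mul] at h1
      rw [h1, ← Finset.sum_sub_distrib]
      refine Finset.sum_congr rfl (fun x hx => ?_)
      have h2 := DD_formula G r x (by simp [LL] at hx; rw [hx]; exact ht)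
      linarith
    have h1 := key G
    have h2 := key H
    rw [← hLL] at h2
    have h3 : ∑ x ∈ LL G d, DD G (r + 1) x = ∑ x ∈ LL G d, DD H (r + 1) x := by
      rw [h1, h2]
      simp only [hD, ih, MM_card_eq hc hdeg hd]
    have h4 : ∑ x ∈ LL G d, DD G (r + 1) x =
        ∑ x ∈ LL G d, (DD H (r + 1) x + (KK G (r + 1) - KK H (r + 1))) :=
      Finset.sum_congr rfl (fun x hx => (DD_rel hc (r + 1)).1 x (fun e => hu (e ▸ hx)))
    rw [h3, Finset.sum_add_distrib] at h4
    rw [Finset.sum_const, nsmul_eq_mul] at h4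
    have h5 : ((LL G d).card : ℤ) * (KK G (r + 1) - KK H (r + 1)) = 0 := by linarith
    rcases mul_eq_zero.1 h5 with h6 | h6
    · have := Finset.card_pos.mpr hL
      omega
    · apply hne; linarith

/-- If every vertex of max degree is adjacent to every other-degree vertex, then `G ≅ H`. -/
lemma closed_case {G H : SimpleGraph V} {v : V} (hc : CI G H v) {d : ℤ}
    (hdeg : ∀ v, dg G v = dg H v) (hd : ∀ v, dg G v ≤ d) (hv : dg G v = d)
    (h1 : ∀ x, dg G x ≠ d → G.Adj x v) (h2 : ∀ x, dg G x ≠ d → H.Adj x v) (r : ℕ) :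
    KK G r = KK H r := by
  obtain ⟨σ, h⟩ := hc
  have hmax : ∀ x, dg G x ≠ d → dg G x ≤ d - 1 := by
    intro x hx
    have := hd x
    omega
  have hadj : ∀ x, x ≠ v → adjZ G x v = adjZ H (σ x) v := by
    intro x hx
    have h3 := h.cdeg hx
    rw [← hdeg (σ x)] at h3
    have b1 := adjZ_le G x v
    have b2 := adjZ_le H (σ x) v
    have b3 := adjZ_nonneg G x v
    have b4 := adjZ_nonneg H (σ x) v
    by_cases c1 : dg G x = d <;> by_cases c2 : dg G (σ x) = d
    · linarith
    · have := adjZ_pos (h2 _ c2)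
      have := hmax _ c2
      linarith
    · have := adjZ_pos (h1 _ c1)
      have := hmax _ c1
      linarith
    · rw [adjZ_pos (h1 _ c1), adjZ_pos (h2 _ c2)]
  have hadj' : ∀ x, x ≠ v → (G.Adj x v ↔ H.Adj (σ x) v) := by
    intro x hx
    have := hadj x hx
    unfold adjZ at this
    by_cases c1 : G.Adj x v <;> by_cases c2 : H.Adj (σ x) v <;> simp [c1, c2] at this ⊢
  apply KK_iso σ
  intro x y
  by_cases hx : x = v
  · by_cases hy : y = v
    · subst hx; subst hy; simp
    · rw [hx, h.1, G.adj_comm, H.adj_comm]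
      exact hadj' y hy
  · by_cases hy : y = v
    · rw [hy, h.1]
      exact hadj' x hx
    · exact h.2 x y hx hy

lemma MM_card_le (G : SimpleGraph V) {d : ℤ} {v : V} (hv : dg G v = d) :
    ((MM G d v).card : ℤ) ≤ (Fintype.card V : ℤ) - 1 - d := by
  have := dg_le_miss G v (MM G d v) (fun y hy => by
    simp [MM] at hy
    exact ⟨hy.2.1, fun h => hy.2.2 h.symm⟩)
  linarith

lemma MM_full (G : SimpleGraph V) {d : ℤ} {v : V} (hv : dg G v = d)
    (h : ((MM G d v).card : ℤ) = (Fintype.card V : ℤ) - 1 - d) :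
    ∀ x, dg G x ≠ d → G.Adj x v := by
  intro x hx
  have := nn_eq G v (MM G d v) (fun y hy => by
    simp [MM] at hy
    exact ⟨hy.2.1, fun h => hy.2.2 h.symm⟩) (by linarith) x (fun e => hx (e ▸ hv))
    (by simp [MM, hx])
  exact this.symm

/-- small intersection with L forces equality of the sums -/
lemma small_p {G H : SimpleGraph V} {u : V} (hc : ∀ v, v ≠ u → CI G H v) {d : ℤ}
    (hdeg : ∀ v, dg G v = dg H v) (hd : ∀ v, dg G v ≤ d) (r : ℕ)
    (hp : ((MM G d u).card : ℤ) < (Fintype.card V : ℤ) - 1 - d) :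
    ∑ x ∈ MM G d u, DD G r x = ∑ x ∈ MM H d u, DD H r x := by
  have hcard := MM_card_eq hc hdeg hd u
  have hm : (MM G d u).val.map (fun x => DD G r x) = (MM H d u).val.map (fun x => DD H r x) := by
    ext k
    have h1 := MM_diff hc hdeg hd r (fun z => if k = z then 1 else 0)
    simp only [Finset.sum_boole] at h1
    rw [Multiset.count_map, Multiset.count_map]
    change (Finset.filter (fun x => k = DD G r x) (MM G d u)).card =
      (Finset.filter (fun x => k = DD H r x) (MM H d u)).card
    have h2 := Finset.card_filter_le (MM G d u) (fun x => k = DD G r x)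
    have h3 := Finset.card_filter_le (MM H d u) (fun x => k = DD H r x)
    have h4 : ((Fintype.card V : ℤ) - 1 - d) ∣
        ((Finset.filter (fun x => k = DD G r x) (MM G d u)).card : ℤ) -
        ((Finset.filter (fun x => k = DD H r x) (MM H d u)).card : ℤ) := ⟨_, h1⟩
    have h5 := Int.eq_zero_of_abs_lt_dvd h4 (by rw [abs_lt]; constructor <;> omega)
    omega
  have := congrArg Multiset.sum hm
  exact this

lemma in_case {G H : SimpleGraph V} {u : V} (hn : 7 ≤ Fintype.card V)
    (hc : ∀ v, v ≠ u → CI G H v) {d : ℤ}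
    (hdeg : ∀ v, dg G v = dg H v) (hd : ∀ v, dg G v ≤ d)
    (hu : u ∈ LL G d) (r : ℕ) (hr : (r : ℤ) ≠ Fintype.card V - (LL G d).card)
    (htriv : ¬ (LL G d = {u} ∧ d = (Fintype.card V : ℤ) - 1)) : KK G r = KK H r := by
  by_contra hne
  have hLL : LL G d = LL H d := by
    unfold LL; simp only [hdeg]
  have hc0 : KK G r - KK H r ≠ 0 := sub_ne_zero.mpr hne
  have hud : dg G u = d := by simpa [LL] using hu
  obtain ⟨hD, hDu⟩ := DD_rel hc r
  set c := KK G r - KK H r with hcdef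
  set n : ℤ := (Fintype.card V : ℤ) with hndef
  have hdiff := MM_diff hc hdeg hd r (fun z => z)
  -- differences
  have hDD : ∀ x, DD G r x - DD H r x = c - (if x = u then (n - r) * c else 0) := by
    intro x
    split_ifs with h
    · subst h; rw [hDu]; ring
    · rw [hD x h]; ring
  have hS1 : ∑ x ∈ LL G d, (DD G r x - DD H r x) = c * ((LL G d).card + r - n) := by
    simp only [hDD, Finset.sum_sub_distrib, Finset.sum_const, nsmul_eq_mul, Finset.sum_ite_eq', hu,
      if_true]
    ring
  simp only [hS1] at hdiff
  have hple := MM_card_le G hud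
  have hp : ((MM G d u).card : ℤ) = n - 1 - d := by
    by_contra hp
    have h1 := small_p hc hdeg hd r (lt_of_le_of_ne hple hp)
    have ht : n - 1 - d ≠ 0 := by omega
    rw [h1, sub_self] at hdiff
    have := hdiff.symm
    simp only [mul_eq_zero, hc0, false_or] at this
    rcases this with h | h
    · exact absurd h ht
    · apply hr
      linarith
  -- second double counting
  have e1 := MM_total_L G d (fun x => DD G r x)
  have e2 := MM_total_L H d (fun x => DD H r x)
  rw [← hLL] at e2
  have e3 : ∑ v ∈ LL G d, (∑ x ∈ MM G d v, DD G r x - ∑ x ∈ MM H d v, DD H r x) =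
      ∑ x ∈ MM G d u, DD G r x - ∑ x ∈ MM H d u, DD H r x := by
    apply Finset.sum_eq_single
    · intro v _ hv
      rw [MM_sum_eq (hc v hv) hd (fun v => hdeg v ▸ hd v) r (fun z => z), sub_self]
    · intro h; exact absurd hu h
  rw [Finset.sum_sub_distrib, e1, e2, ← Finset.sum_sub_distrib, hdiff] at e3
  have e4 : ∑ x ∈ LL G d, (DD G r x * ((MM G d x).card : ℤ) - DD H r x * ((MM H d x).card : ℤ)) =
      c * ∑ x ∈ LL G d, ((MM G d x).card : ℤ) - (n - r) * c * (MM G d u).card := by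
    have : ∀ x, DD G r x * ((MM G d x).card : ℤ) - DD H r x * ((MM H d x).card : ℤ) =
        c * (MM G d x).card - (if x = u then (n - r) * c * (MM G d u).card else 0) := by
      intro x
      rw [← MM_card_eq hc hdeg hd x, ← sub_mul, hDD x]
      split_ifs with h
      · subst h; ring
      · ring
    simp only [this, Finset.sum_sub_distrib, Finset.sum_ite_eq', hu, if_true, Finset.mul_sum]
  rw [e4, hp] at e3
  have e5 : ∑ x ∈ LL G d, ((MM G d x).card : ℤ) = ∑ x ∈ LL G d, (n - 1 - d) := by
    rw [Finset.sum_const, nsmul_eq_mul]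
    apply mul_left_cancel₀ hc0
    linarith
  have e6 : ∀ x ∈ LL G d, ((MM G d x).card : ℤ) = n - 1 - d := by
    apply (Finset.sum_eq_sum_iff_of_le _).1 e5
    intro x hx
    exact MM_card_le G (by simpa [LL] using hx)
  -- another vertex in L
  have hv : ∃ v ∈ LL G d, v ≠ u := by
    by_contra hv
    push Not at hv
    have hL1 : LL G d = {u} := by
      ext x
      simp only [Finset.mem_singleton]
      exact ⟨hv x, fun e => e ▸ hu⟩
    apply htriv
    refine ⟨hL1, ?_⟩
    have : MM G d u = ∅ := by
      ext x
      simp only [MM, Finset.mem_filter, Finset.mem_univ, true_and, Finset.notMem_empty, iff_false]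
      rintro ⟨h1, h2, _⟩
      exact h2 (hv x (by simp [LL, h1]))
    rw [this] at hp
    simp at hp
    linarith
  obtain ⟨v, hvL, hvu⟩ := hv
  have hvd : dg G v = d := by simpa [LL] using hvL
  apply hne
  refine closed_case (hc v hvu) hdeg hd hvd (MM_full G hvd (e6 v hvL)) ?_ r
  intro x hx
  refine MM_full H (by rw [← hdeg, hvd]) ?_ x (by rwa [← hdeg])
  rw [← MM_card_eq hc hdeg hd]
  exact e6 v hvL

lemma dom_case {G H : SimpleGraph V} {u : V} (hn : 7 ≤ Fintype.card V)
    (hc : ∀ v, v ≠ u → CI G H v) {d : ℤ}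
    (hdeg : ∀ v, dg G v = dg H v)
    (hL : LL G d = {u}) (hd : d = (Fintype.card V : ℤ) - 1)
    (r : ℕ) (hr : r + 1 ≠ Fintype.card V) : KK G r = KK H r := by
  have hud : dg G u = d := by
    have : u ∈ LL G d := by rw [hL]; simp
    simpa [LL] using this
  by_cases hrn : Fintype.card V ≤ r
  · -- no cliques
    have key : ∀ G : SimpleGraph V, LL G d = {u} → KK G r = 0 := by
      intro G hL
      unfold KK
      apply Finset.sum_eq_zero
      intro s _
      rw [if_neg]
      intro hs
      have hsu : s = Finset.univ := by
        apply Finset.eq_univ_of_card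
        have h1 := hs.card_eq
        have h2 := Finset.card_le_univ s
        omega
      obtain ⟨v, hv⟩ := exists_notMem ({u} : Finset V) (by simp; omega)
      apply hv
      rw [← hL]
      have h1 := le_dg_miss G v ∅ (fun y h1 h2 => absurd (hs.isClique (x := v) (y := y)
        (by simp [hsu]) (by simp [hsu]) h1.symm) h2)
      have h2 := dg_le G v
      simp at h1
      simp [LL]
      linarith
    have hLL : LL G d = LL H d := by
      unfold LL; simp only [hdeg]
    rw [key G hL, key H (hLL ▸ hL)]
  · have hlt : r + 1 < Fintype.card V := by omega
    clear hrn hr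
    induction r with
    | zero =>
      unfold KK
      refine Finset.sum_congr rfl (fun s _ => ?_)
      simp [SimpleGraph.isNClique_zero]
    | succ r ih =>
      have ih := ih (by omega)
      have hD : DD G r u = DD H r u := by
        have := (DD_rel hc r).2
        rw [ih] at this
        linarith
      have hf : ∀ G : SimpleGraph V, dg G u = d → DD G (r + 1) u + DD G r u = KK G r := by
        intro G hG
        have h1 := DD_formula G r u (by linarith)
        have h2 : ∑ v, (if u ≠ v ∧ ¬ G.Adj u v then DD G r v else 0) = 0 := by
          apply Finset.sum_eq_zero
          intro v _
          rw [if_neg]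
          rintro ⟨a, b⟩
          exact b (nn_eq G u ∅ (by simp) (by simp; linarith) v (Ne.symm a) (by simp))
        linarith
      have h1 := hf G hud
      have h2 := hf H (by rw [← hdeg, hud])
      have h3 := (DD_rel hc (r + 1)).2
      have h4 : ((Fintype.card V : ℤ) - 1 - ((r + 1 : ℕ) : ℤ)) * (KK G (r + 1) - KK H (r + 1)) = 0 := by
        linarith
      rcases mul_eq_zero.1 h4 with h5 | h5
      · push_cast at h5; omega
      · linarith

theorem main_aux {G H : SimpleGraph V} {u : V} (hn : 7 ≤ Fintype.card V)
    (hc : ∀ v, v ≠ u → CI G H v) {d : ℤ} (hd : ∀ v, dg G v ≤ d) (hL : (LL G d).Nonempty)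
    (r : ℕ) (hr : (r : ℤ) ≠ Fintype.card V - (LL G d).card) : KK G r = KK H r := by
  have hdeg := deg_eq hc hn
  by_cases hu : u ∈ LL G d
  · by_cases ht : LL G d = {u} ∧ d = (Fintype.card V : ℤ) - 1
    · refine dom_case hn hc hdeg ht.1 ht.2 r ?_
      rw [ht.1] at hr
      simp at hr
      omega
    · exact in_case hn hc hdeg hd hu r hr ht
  · exact out_case hc hdeg hd hL hu r

lemma kappa_eq (G : SimpleGraph V) (r : ℕ) : (kappa G r : ℤ) = KK G r := by
  unfold kappa KK
  rw [Finset.sum_boole, Set.ncard_eq_toFinset_card']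
  congr 2
  ext s
  simp

lemma deg_eq_dg (G : SimpleGraph V) (v : V) : (deg G v : ℤ) = dg G v := by
  unfold deg
  rw [dg_card, Set.ncard_eq_toFinset_card']
  congr 2
  ext s
  simp

end CliqueCount

theorem clique_count_of_ne {n : ℕ} (hn : 7 ≤ n)
    (G H : SimpleGraph (Fin n)) (hshare : ShareCards G H)
    (r : ℕ) (hr : 1 ≤ r) (hrl : r ≠ n - numMaxDeg G) :
    kappa G r = kappa H r := by
  obtain ⟨u, w, π, h⟩ := hshare
  -- extend π to a permutation
  have hτ : ∃ τ : Equiv.Perm (Fin n), τ u = w ∧ ∀ v : {x : Fin n // x ≠ u}, τ v.1 = (π v).1 := by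
    refine ⟨π.extendSubtype, ?_, ?_⟩
    · by_contra h1
      have h2 := π.extendSubtype_not_mem u (by simp)
      exact h2 h1
    · intro v
      exact π.extendSubtype_apply_of_mem v.1 v.2
  obtain ⟨τ, hτu, hτ⟩ := hτ
  let H' : SimpleGraph (Fin n) := H.comap τ
  have hKH : KK H' r = KK H r := KK_iso τ (fun x y => by simp [H']) r
  have hc : ∀ v, v ≠ u → CI G H' v := by
    intro v hv
    obtain ⟨φ⟩ := h ⟨v, hv⟩
    have hτv : τ v = (π ⟨v, hv⟩).1 := hτ ⟨v, hv⟩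
    let φ' : {x : Fin n // x ≠ v} ≃ {y : Fin n // y ≠ (π ⟨v, hv⟩).1} := φ.toEquiv
    have hρ : ∃ ρ : Equiv.Perm (Fin n), ρ v = τ v ∧
        ∀ x : {x : Fin n // x ≠ v}, ρ x.1 = (φ' x).1 := by
      refine ⟨φ'.extendSubtype, ?_, ?_⟩
      · by_contra h1
        have h2 := φ'.extendSubtype_not_mem v (by simp)
        rw [hτv] at h1
        exact h2 h1
      · intro x
        exact φ'.extendSubtype_apply_of_mem x.1 x.2
    obtain ⟨ρ, hρv, hρ⟩ := hρ
    refine ⟨ρ.trans τ.symm, ?_, ?_⟩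
    · simp [hρv]
    · intro x y hx hy
      have h1 := hρ ⟨x, hx⟩
      have h2 := hρ ⟨y, hy⟩
      simp only at h1 h2
      have h3 := φ.map_rel_iff (a := ⟨x, hx⟩) (b := ⟨y, hy⟩)
      simp only [H', SimpleGraph.comap_adj, Equiv.trans_apply, Equiv.apply_symm_apply]
      rw [h1, h2]
      exact h3.symm
  have hle : ∀ v, deg G v ≤ maxDeg G := fun v =>
    Finset.le_sup (f := fun v => deg G v) (Finset.mem_univ v)
  have hmem : ∀ v, v ∈ LL G (maxDeg G : ℤ) ↔ deg G v = maxDeg G := by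
    intro v
    simp only [LL, Finset.mem_filter, Finset.mem_univ, true_and, ← deg_eq_dg]
    norm_cast
  have hcard : (LL G (maxDeg G : ℤ)).card = numMaxDeg G := by
    unfold numMaxDeg
    congr 1
    ext v
    rw [hmem]; simp
  have hne : (LL G (maxDeg G : ℤ)).Nonempty := by
    have : (Finset.univ : Finset (Fin n)).Nonempty := ⟨⟨0, by omega⟩, Finset.mem_univ _⟩
    obtain ⟨v, _, hv⟩ := Finset.exists_mem_eq_sup Finset.univ this (fun v => deg G v)
    exact ⟨v, (hmem v).2 hv.symm⟩
  have hlen : numMaxDeg G ≤ n := by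
    have := Finset.card_le_univ (LL G (maxDeg G : ℤ))
    rw [hcard] at this
    simpa using this
  have := main_aux (G := G) (H := H') (u := u) (by simpa using hn) hc (d := (maxDeg G : ℤ))
    (fun v => by rw [← deg_eq_dg]; exact_mod_cast hle v) hne r (by
      rw [hcard]; simp; omega)
  have h2 : (kappa G r : ℤ) = kappa H r := by
    rw [kappa_eq, kappa_eq, this, hKH]
  exact_mod_cast h2
end

section
/- Let n ≥ 7 and let G and H be simple graphs on n vertices that share n−1 cards. Suppose Δ(G) = n−2 and let ℓ be the number of vertices of G of degree Δ(G). Then for every integer r ≥ 1 with n − r − ℓ ≠ 0 we have κ_r(G) = κ_r(H). -/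
open SimpleGraph

section Aux
open Classical

/-- Card sharing expressed with permutations fixing the deleted vertex. -/
def Sh {V : Type*} (A B : SimpleGraph V) (u : V) : Prop :=
  ∀ v, v ≠ u → ∃ σ : Equiv.Perm V, σ v = v ∧
    ∀ x y, x ≠ v → y ≠ v → (A.Adj x y ↔ B.Adj (σ x) (σ y))

lemma perm_ne {V : Type*} {σ : Equiv.Perm V} {v x : V} (h : σ v = v) (hx : x ≠ v) : σ x ≠ v :=
  fun h' => hx (σ.injective (h'.trans h.symm))

lemma perm_symm_fix {V : Type*} {σ : Equiv.Perm V} {v : V} (h : σ v = v) : σ.symm v = v := by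
  rw [Equiv.symm_apply_eq]; exact h.symm

lemma Sh.symm {V : Type*} {A B : SimpleGraph V} {u : V} (h : Sh A B u) : Sh B A u := by
  intro v hv
  obtain ⟨σ, h1, h2⟩ := h v hv
  have h3 := perm_symm_fix h1
  refine ⟨σ.symm, h3, fun x y hx hy => ?_⟩
  rw [h2 _ _ (perm_ne h3 hx) (perm_ne h3 hy)]
  simp

lemma Sh.compl {V : Type*} {A B : SimpleGraph V} {u : V} (h : Sh A B u) : Sh Aᶜ Bᶜ u := by
  intro v hv
  obtain ⟨σ, h1, h2⟩ := h v hv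
  refine ⟨σ, h1, fun x y hx hy => ?_⟩
  simp [SimpleGraph.compl_adj, h2 x y hx hy]

variable {V : Type*} [Fintype V]

lemma exists_notMem_list (l : List V) (h : l.length < Fintype.card V) : ∃ t, t ∉ l := by
  by_contra hc
  push Not at hc
  have h1 : (Finset.univ : Finset V) ⊆ l.toFinset := fun t _ => by simpa using hc t
  have h2 := Finset.card_le_card h1
  have h3 := l.toFinset_card_le
  rw [Finset.card_univ] at h2
  omega

/-- neighbours within a list bounds the degree. -/
lemma degree_le_list (A : SimpleGraph V) (x : V) (l : List V) (h : ∀ t, A.Adj x t → t ∈ l) :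
    A.degree x ≤ l.length := by
  rw [← SimpleGraph.card_neighborFinset_eq_degree]
  refine le_trans (Finset.card_le_card (t := l.toFinset) ?_) l.toFinset_card_le
  intro t ht
  simpa using h t (by simpa using ht)

lemma le_degree_list (A : SimpleGraph V) (x : V) (l : List V) (h : ∀ t, t ∉ l → A.Adj x t) :
    Fintype.card V ≤ A.degree x + l.length := by
  rw [← SimpleGraph.card_neighborFinset_eq_degree, ← Finset.card_univ]
  have h1 : (Finset.univ : Finset V) ⊆ A.neighborFinset x ∪ l.toFinset := by
    intro t _
    by_cases ht : t ∈ l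
    · simp [ht]
    · simp [h t ht]
  have h2 := Finset.card_le_card h1
  have h3 := Finset.card_union_le (A.neighborFinset x) l.toFinset
  have h4 := l.toFinset_card_le
  omega

lemma aux_k0 (A B : SimpleGraph V) (u : V) (hS : Sh A B u)
    (hA : A.degree u = 0) (hB : 2 ≤ B.degree u) (hiso : ∀ v, 1 ≤ B.degree v) : False := by
  have hAu : ∀ t, ¬ A.Adj u t := by
    intro t ht
    have := (SimpleGraph.degree_pos_iff_exists_adj A u).2 ⟨t, ht⟩
    omega
  have key : ∀ v : {v // v ≠ u}, ∃ m : {v // v ≠ u}, B.Adj m.1 v.1 ∧ ∀ t, B.Adj m.1 t → t = v.1 := by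
    rintro ⟨v, hv⟩
    obtain ⟨σ, h1, h2⟩ := hS v hv
    have hn : ∀ t, B.Adj (σ u) t → t = v := by
      intro t ht
      by_contra htv
      have h3 := perm_symm_fix h1
      have := (h2 u (σ.symm t) hv.symm (perm_ne h3 htv)).2 (by simpa using ht)
      exact hAu _ this
    obtain ⟨t, ht⟩ := (SimpleGraph.degree_pos_iff_exists_adj B (σ u)).1 (hiso _)
    have := hn t ht
    subst this
    refine ⟨⟨σ u, fun hu => ?_⟩, ht, hn⟩
    have := degree_le_list B (σ u) [t] (by simpa using hn)
    rw [hu] at this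
    simp at this
    omega
  choose m hm1 hm2 using key
  have hinj : Function.Injective m := by
    intro v v' h
    apply Subtype.ext
    apply hm2 v' v.1
    rw [← h]
    exact hm1 v
  have hsurj := Finite.surjective_of_injective hinj
  obtain ⟨t, ht⟩ := (SimpleGraph.degree_pos_iff_exists_adj B u).1 (by omega)
  obtain ⟨v, hv⟩ := hsurj ⟨t, ht.ne'⟩
  have := hm2 v u (by rw [hv]; exact ht.symm)
  exact v.2 this.symm

lemma aux_k2 (A B : SimpleGraph V) (u : V) (hS : Sh A B u) (hn : 7 ≤ Fintype.card V)
    (hd : ∀ v, v ≠ u → A.degree v = B.degree v + 1)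
    (hA : A.degree u = 2) (hB : Fintype.card V ≤ B.degree u + 1) : False := by
  have hBu : ∀ t, t ≠ u → B.Adj u t := by
    intro t htu
    by_contra h
    have h2 : (B.neighborFinset u) ⊆ Finset.univ \ {u, t} := by
      intro s hs
      have : B.Adj u s := by simpa using hs
      simp only [Finset.mem_sdiff, Finset.mem_univ, Finset.mem_insert, Finset.mem_singleton, true_and]
      rintro (rfl | rfl)
      · exact B.irrefl this
      · exact h this
    have h3 := Finset.card_le_card h2
    rw [Finset.card_sdiff_of_subset (Finset.subset_univ _), Finset.card_pair htu.symm,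
      SimpleGraph.card_neighborFinset_eq_degree, Finset.card_univ] at h3
    omega
  rw [← SimpleGraph.card_neighborFinset_eq_degree, Finset.card_eq_two] at hA
  obtain ⟨x, y, hxy, hN⟩ := hA
  have hAu : ∀ t, A.Adj u t ↔ t = x ∨ t = y := by
    intro t
    rw [← SimpleGraph.mem_neighborFinset, hN]; simp
  have hux := (hAu x).2 (Or.inl rfl)
  have huy := (hAu y).2 (Or.inr rfl)
  have huni : ∀ v, v ≠ u → ∃ z, z ≠ v ∧ (z = x ∨ z = y) ∧ ∀ t, t ≠ v → t ≠ z → A.Adj z t := by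
    intro v hv
    obtain ⟨σ, h1, h2⟩ := hS v hv
    have h3 := perm_symm_fix h1
    have hz : ∀ t, t ≠ v → t ≠ σ.symm u → A.Adj (σ.symm u) t := by
      intro t ht htz
      rw [h2 _ _ (perm_ne h3 hv.symm) ht]
      simp only [Equiv.apply_symm_apply]
      apply hBu
      rintro h
      exact htz (by rw [← h]; simp)
    have hzu : σ.symm u ≠ u := by
      intro h
      obtain ⟨t, ht⟩ := exists_notMem_list [x, y, v, u] (by simp; omega)
      simp only [List.mem_cons, List.not_mem_nil, not_or, or_false] at ht
      have := hz t ht.2.2.1 (by rw [h]; exact ht.2.2.2)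
      rw [h, hAu] at this
      tauto
    exact ⟨σ.symm u, perm_ne h3 hv.symm, (hAu _).1 (hz u hv.symm hzu.symm).symm, hz⟩
  obtain ⟨v0, hv0⟩ := exists_notMem_list [u, x, y] (by simp; omega)
  simp only [List.mem_cons, List.not_mem_nil, not_or, or_false] at hv0
  have hxyA : A.Adj x y := by
    obtain ⟨z, h1, h2, h3⟩ := huni v0 hv0.1
    rcases h2 with rfl | rfl
    · exact h3 _ (Ne.symm hv0.2.2) hxy.symm
    · exact (h3 _ (Ne.symm hv0.2.1) hxy).symm
  have hx : ∀ t, t ≠ x → A.Adj x t := by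
    intro t ht
    by_cases hty : t = y
    · rw [hty]; exact hxyA
    obtain ⟨z, h1, h2, h3⟩ := huni y huy.ne'
    have : z = x := by tauto
    subst this
    exact h3 t hty ht
  have hy : ∀ t, t ≠ y → A.Adj y t := by
    intro t ht
    by_cases hty : t = x
    · rw [hty]; exact hxyA.symm
    obtain ⟨z, h1, h2, h3⟩ := huni x hux.ne'
    have : z = y := by tauto
    subst this
    exact h3 t hty ht
  have key : ∀ v, v ≠ u → v ≠ x → v ≠ y → ∃ s, (s = x ∨ s = y) ∧ ∀ t, t ≠ v → t ≠ s → B.Adj s t := by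
    intro v hvu hvx hvy
    obtain ⟨σ, h1, h2⟩ := hS v hvu
    have h3 := perm_symm_fix h1
    have tr : ∀ z, z ≠ v → (∀ t, t ≠ z → A.Adj z t) → ∀ t, t ≠ v → t ≠ σ z → B.Adj (σ z) t := by
      intro z hzv hz t ht htz
      have := (h2 z (σ.symm t) hzv (perm_ne h3 ht)).1 (hz _ (by
        intro h; apply htz; rw [← h]; simp))
      simpa using this
    have fin : ∀ s, s ≠ u → (∀ t, t ≠ v → t ≠ s → B.Adj s t) → (s = x ∨ s = y) := by
      intro s hsu hs
      have h5 := le_degree_list B s [v, s] (by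
        intro t ht
        simp only [List.mem_cons, List.not_mem_nil, not_or, or_false] at ht
        exact hs t ht.1 ht.2)
      have h6 := hd s hsu
      simp only [List.length_cons, List.length_nil] at h5
      rw [← hAu]
      by_contra hc
      have h7 : A.neighborFinset s ⊆ Finset.univ \ {s, u} := by
        intro t ht
        have : A.Adj s t := by simpa using ht
        simp only [Finset.mem_sdiff, Finset.mem_univ, Finset.mem_insert, Finset.mem_singleton, true_and]
        rintro (rfl | rfl)
        · exact A.irrefl this
        · exact hc this.symm
      have h8 := Finset.card_le_card h7
      rw [Finset.card_sdiff_of_subset (Finset.subset_univ _), Finset.card_pair hsu,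
        SimpleGraph.card_neighborFinset_eq_degree, Finset.card_univ] at h8
      omega
    by_cases hsx : σ x = u
    · have : σ y ≠ u := fun h => hxy (σ.injective (hsx.trans h.symm))
      exact ⟨σ y, fin _ this (tr y hvy.symm hy), tr y hvy.symm hy⟩
    · exact ⟨σ x, fin _ hsx (tr x hvx.symm hx), tr x hvx.symm hx⟩
  obtain ⟨v1, hv1⟩ := exists_notMem_list [u, x, y, v0] (by simp; omega)
  obtain ⟨v2, hv2⟩ := exists_notMem_list [u, x, y, v0, v1] (by simp; omega)
  simp only [List.mem_cons, List.not_mem_nil, not_or, or_false] at hv1 hv2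
  have two : ∀ s a b, s ≠ u → a ≠ b → (∀ t, t ≠ a → t ≠ s → B.Adj s t) →
      (∀ t, t ≠ b → t ≠ s → B.Adj s t) → False := by
    intro s a b hsu hab h1 h2
    have h5 := le_degree_list B s [s] (by
      intro t ht
      simp only [List.mem_cons, List.not_mem_nil, or_false] at ht
      by_cases hta : t = a
      · exact h2 t (hta ▸ hab) ht
      · exact h1 t hta ht)
    have h6 := hd s hsu
    have h7 := A.degree_lt_card_verts s
    simp only [List.length_cons, List.length_nil] at h5
    omega
  obtain ⟨s0, e0, k0⟩ := key v0 hv0.1 hv0.2.1 hv0.2.2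
  obtain ⟨s1, e1, k1⟩ := key v1 hv1.1 hv1.2.1 hv1.2.2.1
  obtain ⟨s2, e2, k2⟩ := key v2 hv2.1 hv2.2.1 hv2.2.2.1
  have s0u : s0 ≠ u := by rcases e0 with rfl | rfl; exacts [hux.ne', huy.ne']
  have s1u : s1 ≠ u := by rcases e1 with rfl | rfl; exacts [hux.ne', huy.ne']
  by_cases h01 : s0 = s1
  · subst h01
    exact two s0 v0 v1 s0u (Ne.symm hv1.2.2.2) k0 k1
  · by_cases h02 : s0 = s2
    · subst h02
      exact two s0 v0 v2 s0u (Ne.symm hv2.2.2.2.1) k0 k2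
    · have : s1 = s2 := by
        rcases e0 with rfl | rfl <;> rcases e1 with rfl | rfl <;> rcases e2 with rfl | rfl <;> tauto
      subst this
      exact two s1 v1 v2 s1u (Ne.symm hv2.2.2.2.2) k1 k2

lemma exists_nonadj (B : SimpleGraph V) (s : V) (h : B.degree s + 2 ≤ Fintype.card V) :
    ∃ t, t ≠ s ∧ ¬ B.Adj s t := by
  by_contra hc
  push Not at hc
  have := le_degree_list B s [s] (by
    intro t ht
    simp only [List.mem_cons, List.not_mem_nil, or_false] at ht
    exact hc t ht)
  simp only [List.length_cons, List.length_nil] at this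
  omega

lemma aux_k1 (A B : SimpleGraph V) (u : V) (hS : Sh A B u) (hn : 7 ≤ Fintype.card V)
    (hd : ∀ v, v ≠ u → A.degree v = B.degree v + 1)
    (hA : A.degree u = 1) (hB : B.degree u + 2 = Fintype.card V) : False := by
  obtain ⟨q, hqu, hq⟩ := exists_nonadj B u (by omega)
  have hBu : ∀ t, t ≠ u → t ≠ q → B.Adj u t := by
    intro t htu htq
    by_contra h
    have h2 : (B.neighborFinset u) ⊆ Finset.univ \ {u, t, q} := by
      intro s hs
      have : B.Adj u s := by simpa using hs
      simp only [Finset.mem_sdiff, Finset.mem_univ, Finset.mem_insert, Finset.mem_singleton, true_and]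
      rintro (rfl | rfl | rfl)
      · exact B.irrefl this
      · exact h this
      · exact hq this
    have h3 := Finset.card_le_card h2
    rw [Finset.card_sdiff_of_subset (Finset.subset_univ _),
      Finset.card_eq_three.2 ⟨u, t, q, htu.symm, hqu.symm, htq, rfl⟩,
      SimpleGraph.card_neighborFinset_eq_degree, Finset.card_univ] at h3
    omega
  rw [← SimpleGraph.card_neighborFinset_eq_degree, Finset.card_eq_one] at hA
  obtain ⟨z, hN⟩ := hA
  have hAu : ∀ t, A.Adj u t ↔ t = z := by
    intro t
    rw [← SimpleGraph.mem_neighborFinset, hN]; simp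
  have huz := (hAu z).2 rfl
  have hzu : z ≠ u := huz.ne'
  obtain ⟨s, hsu, hsq, hs, hzq, hz⟩ : ∃ s, s ≠ u ∧ s ≠ q ∧ (∀ t, B.Adj s t → t = u ∨ t = q) ∧
      z ≠ q ∧ ∀ t, t ≠ q → t ≠ z → A.Adj z t := by
    obtain ⟨σ, h1, h2⟩ := hS q hqu
    have h3 := perm_symm_fix h1
    have hz : ∀ t, t ≠ q → t ≠ σ.symm u → A.Adj (σ.symm u) t := by
      intro t ht htz
      rw [h2 _ _ (perm_ne h3 hqu.symm) ht]
      simp only [Equiv.apply_symm_apply]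
      apply hBu
      · intro h
        exact htz (by rw [← h]; simp)
      · exact perm_ne h1 ht
    have hzu' : σ.symm u ≠ u := by
      intro h
      obtain ⟨t, ht⟩ := exists_notMem_list [z, q, u] (by simp; omega)
      simp only [List.mem_cons, List.not_mem_nil, not_or, or_false] at ht
      have := hz t ht.2.1 (by rw [h]; exact ht.2.2)
      rw [h, hAu] at this
      tauto
    have hzz : σ.symm u = z := (hAu _).1 (hz u hqu.symm hzu'.symm).symm
    have hsz : σ z = u := by rw [← hzz]; simp
    have hzq : z ≠ q := by rw [← hzz]; exact perm_ne h3 hqu.symm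
    refine ⟨σ u, ?_, perm_ne h1 hqu.symm, ?_, hzq, by rw [← hzz]; exact hz⟩
    · intro h
      exact hzu (σ.injective (hsz.trans h.symm))
    · intro t ht
      by_cases htq : t = q
      · exact Or.inr htq
      left
      have := (h2 u (σ.symm t) hqu.symm (perm_ne h3 htq)).2 (by simpa using ht)
      rw [hAu, Equiv.symm_apply_eq, hsz] at this
      exact this
  obtain ⟨z2, hqB, hz2u, hz2z, hz2⟩ : ∃ z2, (∀ t, B.Adj q t → t = z) ∧ z2 ≠ u ∧ z2 ≠ z ∧
      ∀ t, t ≠ z2 → t ≠ z → t ≠ u → A.Adj z2 t := by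
    obtain ⟨σ, h1, h2⟩ := hS z hzu
    have h3 := perm_symm_fix h1
    have hiso : ∀ t, B.Adj (σ u) t → t = z := by
      intro t ht
      by_contra htz
      have := (h2 u (σ.symm t) hzu.symm (perm_ne h3 htz)).2 (by simpa using ht)
      rw [hAu] at this
      exact perm_ne h3 htz this
    have hsu' : σ u = q := by
      by_contra hne
      by_cases huu : σ u = u
      · rw [huu] at hiso
        obtain ⟨t, ht⟩ := exists_notMem_list [z, q, u] (by simp; omega)
        simp only [List.mem_cons, List.not_mem_nil, not_or, or_false] at ht
        exact ht.1 (hiso t (hBu t ht.2.2 ht.2.1))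
      · exact hzu (hiso u (hBu _ huu hne).symm).symm
    rw [hsu'] at hiso
    refine ⟨σ.symm u, hiso, ?_, perm_ne h3 hzu.symm, ?_⟩
    · intro h
      rw [Equiv.symm_apply_eq, hsu'] at h
      exact hqu h.symm
    · intro t ht htz htu
      rw [h2 _ _ (perm_ne h3 hzu.symm) htz]
      simp only [Equiv.apply_symm_apply]
      apply hBu
      · intro h
        exact ht (by rw [← h]; simp)
      · intro h
        rw [← hsu'] at h
        exact htu (σ.injective h)
  have hz2q : z2 ≠ q := by
    rintro rfl
    have h5 := degree_le_list B z2 [z] (by simpa using hqB)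
    have h6 := le_degree_list A z2 [z2, z, u] (by
      intro t ht
      simp only [List.mem_cons, List.not_mem_nil, not_or, or_false] at ht
      exact hz2 t ht.1 ht.2.1 ht.2.2)
    have h7 := hd z2 hqu
    simp only [List.length_cons, List.length_nil] at h5 h6
    omega
  have hzz2 : A.Adj z z2 := hz z2 hz2q hz2z
  have hzqA : ¬ A.Adj z q := by
    intro hzqA
    obtain ⟨v, hv⟩ := exists_notMem_list [u, z, q, s] (by simp; omega)
    simp only [List.mem_cons, List.not_mem_nil, not_or, or_false] at hv
    obtain ⟨hvu, hvz, hvq, hvs⟩ := hv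
    obtain ⟨σ, h1, h2⟩ := hS v hvu
    have h3 := perm_symm_fix h1
    have hx : ∀ t, t ≠ v → t ≠ σ z → B.Adj (σ z) t := by
      intro t ht htz
      have hne : σ.symm t ≠ z := by intro h; apply htz; rw [← h]; simp
      have := (h2 z (σ.symm t) (Ne.symm hvz) (perm_ne h3 ht)).1 (by
        by_cases h : σ.symm t = q
        · rw [h]; exact hzqA
        · exact hz _ h hne)
      simpa using this
    have hxs : σ z ≠ s := by
      intro h
      rw [h] at hx
      obtain ⟨t, ht⟩ := exists_notMem_list [v, s, u, q] (by simp; omega)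
      simp only [List.mem_cons, List.not_mem_nil, not_or, or_false] at ht
      have := hs t (hx t ht.1 ht.2.1)
      tauto
    rcases hs _ (hx s (Ne.symm hvs) hxs.symm).symm with h | h
    · rw [h] at hx
      exact hq (hx q (Ne.symm hvq) hqu)
    · rw [h] at hx
      obtain ⟨t, ht⟩ := exists_notMem_list [v, q, z] (by simp; omega)
      simp only [List.mem_cons, List.not_mem_nil, not_or, or_false] at ht
      exact ht.2.2 (hqB t (hx t ht.1 ht.2.1))
  have key : ∀ v, v ≠ u → v ≠ z → v ≠ q → v ≠ s → v ≠ z2 →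
      ∀ t, t ≠ z → t ≠ s → t ≠ v → B.Adj z t := by
    intro v hvu hvz hvq hvs hvz2
    obtain ⟨σ, h1, h2⟩ := hS v hvu
    have h3 := perm_symm_fix h1
    obtain ⟨x, p, hxu, hxv, hx⟩ : ∃ x p, x ≠ u ∧ x ≠ v ∧ ∀ t, t ≠ x → t ≠ p → t ≠ v → B.Adj x t := by
      by_cases hzu' : σ z = u
      · have hne : σ z2 ≠ u := fun h => hz2z (σ.injective (h.trans hzu'.symm))
        refine ⟨σ z2, σ u, hne, perm_ne h1 hvz2.symm, fun t ht1 ht2 ht3 => ?_⟩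
        have e1 : σ.symm t ≠ z2 := by intro h; apply ht1; rw [← h]; simp
        have e2 : σ.symm t ≠ u := by intro h; apply ht2; rw [← h]; simp
        have := (h2 z2 (σ.symm t) hvz2.symm (perm_ne h3 ht3)).1 (by
          by_cases h : σ.symm t = z
          · rw [h]; exact hzz2.symm
          · exact hz2 _ e1 h e2)
        simpa using this
      · refine ⟨σ z, σ q, hzu', perm_ne h1 hvz.symm, fun t ht1 ht2 ht3 => ?_⟩
        have e1 : σ.symm t ≠ z := by intro h; apply ht1; rw [← h]; simp
        have e2 : σ.symm t ≠ q := by intro h; apply ht2; rw [← h]; simp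
        have := (h2 z (σ.symm t) hvz.symm (perm_ne h3 ht3)).1 (hz _ e2 e1)
        simpa using this
    have hxq : x ≠ q := by
      rintro rfl
      obtain ⟨t, ht⟩ := exists_notMem_list [x, p, v, z] (by simp; omega)
      simp only [List.mem_cons, List.not_mem_nil, not_or, or_false] at ht
      exact ht.2.2.2 (hqB t (hx t ht.1 ht.2.1 ht.2.2.1))
    have hxs : x ≠ s := by
      rintro rfl
      obtain ⟨t, ht⟩ := exists_notMem_list [x, p, v, u, q] (by simp; omega)
      simp only [List.mem_cons, List.not_mem_nil, not_or, or_false] at ht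
      have := hs t (hx t ht.1 ht.2.1 ht.2.2.1)
      tauto
    have hps : s = p := by
      by_contra h
      have := hs x (hx s hxs.symm h hvs.symm).symm
      tauto
    have hxz : x = z := hqB x (hx q hxq.symm (by rw [← hps]; exact hsq.symm) hvq.symm).symm
    intro t h4 h5 h6
    rw [← hxz]
    exact hx t (by rw [hxz]; exact h4) (by rw [← hps]; exact h5) h6
  obtain ⟨v1, hv1⟩ := exists_notMem_list [u, z, q, s, z2] (by simp; omega)
  obtain ⟨v2, hv2⟩ := exists_notMem_list [u, z, q, s, z2, v1] (by simp; omega)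
  simp only [List.mem_cons, List.not_mem_nil, not_or, or_false] at hv1 hv2
  obtain ⟨a1, a2, a3, a4, a5⟩ := hv1
  obtain ⟨b1, b2, b3, b4, b5, b6⟩ := hv2
  have h5 := le_degree_list B z [z, s] (by
    intro t ht
    simp only [List.mem_cons, List.not_mem_nil, not_or, or_false] at ht
    by_cases h : t = v1
    · exact key v2 b1 b2 b3 b4 b5 t ht.1 ht.2 (h ▸ Ne.symm b6)
    · exact key v1 a1 a2 a3 a4 a5 t ht.1 ht.2 h)
  have h6 := hd z hzu
  have h7 : A.neighborFinset z ⊆ Finset.univ \ {z, q} := by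
    intro t ht
    have : A.Adj z t := by simpa using ht
    simp only [Finset.mem_sdiff, Finset.mem_univ, Finset.mem_insert, Finset.mem_singleton, true_and]
    rintro (rfl | rfl)
    · exact A.irrefl this
    · exact hzqA this
  have h8 := Finset.card_le_card h7
  rw [Finset.card_sdiff_of_subset (Finset.subset_univ _), Finset.card_pair hzq,
    SimpleGraph.card_neighborFinset_eq_degree, Finset.card_univ] at h8
  simp only [List.length_cons, List.length_nil] at h5
  omega

lemma size_aux (A B : SimpleGraph V) (u : V) (hS : Sh A B u) (hn : 7 ≤ Fintype.card V)
    (hd : ∀ v, v ≠ u → A.degree v = B.degree v + 1)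
    (hu : B.degree u + 3 = A.degree u + Fintype.card V)
    (hiso : (∀ v, 1 ≤ A.degree v) ∨ (∀ v, 1 ≤ B.degree v)) : False := by
  have h1 := B.degree_lt_card_verts u
  have h2 : A.degree u = 0 ∨ A.degree u = 1 ∨ A.degree u = 2 := by omega
  rcases h2 with h2 | h2 | h2
  · rcases hiso with h | h
    · have := h u; omega
    · exact aux_k0 A B u hS h2 (by omega) h
  · exact aux_k1 A B u hS hn hd h2 (by omega)
  · exact aux_k2 A B u hS hn hd h2 (by omega)

/-- number of ordered adjacent pairs avoiding `v`. -/
lemma pairs_avoid (A : SimpleGraph V) (v : V) :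
    (∑ x, (A.degree x : ℤ)) - 2 * A.degree v =
      ∑ x, ∑ y, if x ≠ v ∧ y ≠ v ∧ A.Adj x y then (1 : ℤ) else 0 := by
  have hdeg : ∀ x, (A.degree x : ℤ) = ∑ y, if A.Adj x y then (1 : ℤ) else 0 := by
    intro x
    rw [← SimpleGraph.card_neighborFinset_eq_degree, SimpleGraph.neighborFinset_eq_filter]
    simp
  have h1 : ∀ x y, (if x ≠ v ∧ y ≠ v ∧ A.Adj x y then (1 : ℤ) else 0) =
      (if A.Adj x y then (1 : ℤ) else 0) - (if x = v then (if A.Adj v y then (1 : ℤ) else 0) else 0)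
        - (if y = v then (if A.Adj v x then (1 : ℤ) else 0) else 0) := by
    intro x y
    by_cases hx : x = v <;> by_cases hy : y = v
    · subst hx; subst hy; simp
    · subst hx; simp [hy]
    · subst hy; simp [hx, A.adj_comm]
    · simp [hx, hy]
  simp_rw [h1, Finset.sum_sub_distrib, ← hdeg]
  simp only [Finset.sum_ite_eq', Finset.mem_univ, if_true]
  rw [← hdeg]
  have : ∑ x, ∑ y, (if x = v then (if A.Adj v y then (1 : ℤ) else 0) else 0) = A.degree v := by
    rw [Finset.sum_comm]
    simp only [Finset.sum_ite_eq', Finset.mem_univ, if_true]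
    rw [← hdeg]
  rw [this]; ring

lemma degree_eq_of_Sh (A B : SimpleGraph V) (u : V) (hS : Sh A B u) (hn : 7 ≤ Fintype.card V)
    (hiso : ∀ v, 1 ≤ A.degree v) : ∀ v, A.degree v = B.degree v := by
  have h1 : ∀ v, v ≠ u → (∑ x, (A.degree x : ℤ)) - 2 * A.degree v =
      (∑ x, (B.degree x : ℤ)) - 2 * B.degree v := by
    intro v hv
    obtain ⟨σ, h1, h2⟩ := hS v hv
    rw [pairs_avoid, pairs_avoid]
    symm
    rw [← Equiv.sum_comp σ]
    apply Finset.sum_congr rfl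
    intro x _
    rw [← Equiv.sum_comp σ]
    apply Finset.sum_congr rfl
    intro y _
    have e : ∀ x, σ x = v ↔ x = v := by
      intro x
      constructor
      · intro h; by_contra h'; exact perm_ne h1 h' h
      · rintro rfl; exact h1
    by_cases hx : x = v
    · simp [hx, h1]
    by_cases hy : y = v
    · simp [hy, h1]
    simp [hx, hy, e, h2 x y hx hy]
  obtain ⟨v0, hv0⟩ := exists_notMem_list [u] (by simp; omega)
  simp only [List.mem_cons, List.not_mem_nil, or_false] at hv0
  obtain ⟨e, he⟩ : ∃ e : ℤ, e = A.degree v0 - B.degree v0 := ⟨_, rfl⟩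
  have h2 : ∀ v, v ≠ u → (A.degree v : ℤ) - B.degree v = e := by
    intro v hv
    have := h1 v hv
    have := h1 v0 hv0
    omega
  have h3 : (∑ x, (A.degree x : ℤ)) - (∑ x, (B.degree x : ℤ)) = 2 * e := by
    have := h1 v0 hv0
    omega
  rw [← Finset.sum_sub_distrib, ← Finset.add_sum_erase _ _ (Finset.mem_univ u),
    Finset.sum_congr rfl (fun x hx => h2 x (Finset.ne_of_mem_erase hx)), Finset.sum_const,
    Finset.card_erase_of_mem (Finset.mem_univ u), Finset.card_univ, nsmul_eq_mul,
    Nat.cast_sub (by omega)] at h3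
  push_cast at h3
  have hA := A.degree_lt_card_verts u
  have hB := B.degree_lt_card_verts u
  have e0 : e ≤ 1 := by
    by_contra hc
    push Not at hc
    have : (0 : ℤ) ≤ (e - 2) * ((Fintype.card V : ℤ) - 3) := mul_nonneg (by omega) (by omega)
    nlinarith
  have e1 : -1 ≤ e := by
    by_contra hc
    push Not at hc
    have : (0 : ℤ) ≤ (-2 - e) * ((Fintype.card V : ℤ) - 3) := mul_nonneg (by omega) (by omega)
    nlinarith
  have h4 : e = 0 ∨ e = 1 ∨ e = -1 := by omega
  rcases h4 with rfl | rfl | rfl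
  · intro v
    by_cases hv : v = u
    · subst hv; omega
    · have := h2 v hv; omega
  · exfalso
    refine size_aux A B u hS hn (fun v hv => ?_) (by omega) (Or.inl hiso)
    have := h2 v hv; omega
  · exfalso
    refine size_aux B A u hS.symm hn (fun v hv => ?_) (by omega) (Or.inr hiso)
    have := h2 v hv; omega

/-- independent sets of size `r`. -/
noncomputable def ind (A : SimpleGraph V) (r : ℕ) : Finset (Finset V) :=
  Finset.univ.filter (fun s => s.card = r ∧ ∀ x ∈ s, ∀ y ∈ s, ¬ A.Adj x y)

/-- number of independent `r`-sets containing `v`. -/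
noncomputable def Dg (A : SimpleGraph V) (r : ℕ) (v : V) : ℕ :=
  ((ind A r).filter (fun s => v ∈ s)).card

lemma mem_ind {A : SimpleGraph V} {r : ℕ} {s : Finset V} :
    s ∈ ind A r ↔ s.card = r ∧ ∀ x ∈ s, ∀ y ∈ s, ¬ A.Adj x y := by
  simp [ind]

lemma ind_transfer (A B : SimpleGraph V) (r : ℕ) (σ : Equiv.Perm V) (P : Finset V → Prop)
    (Q : Finset V → Prop) [DecidablePred P] [DecidablePred Q] (hPQ : ∀ s, P s ↔ Q (s.map σ.toEmbedding))
    (h : ∀ s, P s → ∀ x ∈ s, ∀ y ∈ s, (A.Adj x y ↔ B.Adj (σ x) (σ y))) :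
    ((ind A r).filter P).card = ((ind B r).filter Q).card := by
  refine Finset.card_equiv σ.finsetCongr (fun s => ?_)
  simp only [Finset.mem_filter, mem_ind, Equiv.finsetCongr_apply, Finset.card_map, ← hPQ]
  constructor
  · rintro ⟨⟨h1, h2⟩, h3⟩
    refine ⟨⟨h1, ?_⟩, h3⟩
    intro x hx y hy
    simp only [Finset.mem_map_equiv] at hx hy
    have := h s h3 _ hx _ hy
    simp only [Equiv.apply_symm_apply] at this
    rw [← this]
    exact h2 _ hx _ hy
  · rintro ⟨⟨h1, h2⟩, h3⟩
    refine ⟨⟨h1, ?_⟩, h3⟩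
    intro x hx y hy
    rw [h s h3 _ hx _ hy]
    exact h2 _ (by simpa using hx) _ (by simpa using hy)

lemma ind_split (A : SimpleGraph V) (r : ℕ) (v : V) :
    (ind A r).card = Dg A r v + ((ind A r).filter (fun s => v ∉ s)).card := by
  rw [Dg, Finset.card_filter_add_card_filter_not]

lemma sum_Dg (A : SimpleGraph V) (r : ℕ) : ∑ v, Dg A r v = r * (ind A r).card := by
  have : ∀ v, Dg A r v = ∑ s ∈ ind A r, if v ∈ s then 1 else 0 := by
    intro v; rw [Dg, Finset.card_filter]
  simp_rw [this]
  rw [Finset.sum_comm]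
  have : ∀ s ∈ ind A r, (∑ v, if v ∈ s then 1 else 0) = r := by
    intro s hs
    rw [← (mem_ind.1 hs).1]
    simp
  rw [Finset.sum_congr rfl this]
  simp [mul_comm]

/-- leaves attached to `v`. -/
noncomputable def lf (A : SimpleGraph V) (v : V) : Finset V :=
  Finset.univ.filter (fun x => A.degree x = 1 ∧ A.Adj x v)

lemma mem_lf {A : SimpleGraph V} {v x : V} : x ∈ lf A v ↔ A.degree x = 1 ∧ A.Adj x v := by
  simp [lf]

lemma lf_unique {A : SimpleGraph V} {v x t : V} (h : x ∈ lf A v) (ht : A.Adj x t) : t = v := by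
  obtain ⟨h1, h2⟩ := mem_lf.1 h
  rw [← SimpleGraph.card_neighborFinset_eq_degree] at h1
  exact Finset.card_le_one.1 h1.le t (by simpa using ht) v (by simpa using h2)

lemma mem_lf' {A : SimpleGraph V} (hA : ∀ v, 1 ≤ A.degree v) {v x : V} :
    x ∈ lf A v ↔ ∀ t, A.Adj x t → t = v := by
  refine ⟨fun h t ht => lf_unique h ht, fun h => mem_lf.2 ?_⟩
  obtain ⟨t, ht⟩ := (SimpleGraph.degree_pos_iff_exists_adj A x).1 (hA x)
  have h1 := degree_le_list A x [v] (by simpa using h)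
  have h2 := hA x
  simp only [List.length_cons, List.length_nil] at h1
  exact ⟨by omega, h t ht ▸ ht⟩

lemma sum_leaves (A : SimpleGraph V) (g : V → ℤ) :
    ∑ x ∈ Finset.univ.filter (fun x => A.degree x = 1), g x = ∑ v, ∑ x ∈ lf A v, g x := by
  have h : ∀ v, ∑ x ∈ lf A v, g x =
      ∑ x ∈ Finset.univ.filter (fun x => A.degree x = 1), if A.Adj x v then g x else 0 := by
    intro v
    rw [← Finset.sum_filter, Finset.filter_filter]
    rfl
  simp_rw [h]
  rw [Finset.sum_comm]
  apply Finset.sum_congr rfl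
  intro x hx
  have hx : A.degree x = 1 := by simpa using hx
  rw [← Finset.sum_filter, Finset.sum_const, ← SimpleGraph.neighborFinset_eq_filter,
    SimpleGraph.card_neighborFinset_eq_degree, hx, one_smul]

lemma Dg_leaf {A : SimpleGraph V} {v x : V} (h : A.Adj x v) (r : ℕ) :
    Dg A r x = ((ind A r).filter (fun s => v ∉ s ∧ x ∈ s)).card := by
  rw [Dg]
  congr 1
  apply Finset.filter_congr
  intro s hs
  refine ⟨fun hx => ⟨fun hv => (mem_ind.1 hs).2 x hx v hv h, hx⟩, fun h => h.2⟩

lemma Dg_rec {A : SimpleGraph V} {v x : V} (h : x ∈ lf A v) (r : ℕ) :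
    ((ind A r).filter (fun s => v ∉ s)).card = Dg A r x + Dg A (r + 1) x := by
  have hxv := (mem_lf.1 h).2
  rw [Dg_leaf hxv, ← Finset.card_filter_add_card_filter_not (fun s => x ∈ s), Finset.filter_filter,
    Finset.filter_filter]
  congr 1
  rw [Dg]
  refine Finset.card_bij' (fun s _ => insert x s) (fun s _ => s.erase x) ?_ ?_ ?_ ?_
  · intro s hs
    simp only [Finset.mem_filter, mem_ind] at hs ⊢
    obtain ⟨⟨h1, h2⟩, h3, h4⟩ := hs
    refine ⟨⟨by rw [Finset.card_insert_of_notMem h4, h1], ?_⟩, by simp⟩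
    have hx : ∀ y ∈ s, ¬ A.Adj x y := fun y hy hxy => h3 (lf_unique h hxy ▸ hy)
    intro a ha b hb
    rcases Finset.mem_insert.1 ha with rfl | ha' <;> rcases Finset.mem_insert.1 hb with rfl | hb'
    · exact A.irrefl
    · exact hx b hb'
    · exact fun hab => hx a ha' hab.symm
    · exact h2 a ha' b hb'
  · intro s hs
    simp only [Finset.mem_filter, mem_ind] at hs ⊢
    obtain ⟨⟨h1, h2⟩, h3⟩ := hs
    refine ⟨⟨by rw [Finset.card_erase_of_mem h3, h1]; rfl, fun a ha b hb =>
      h2 a (Finset.mem_of_mem_erase ha) b (Finset.mem_of_mem_erase hb)⟩, fun hv => ?_, by simp⟩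
    exact h2 x h3 v (Finset.mem_of_mem_erase hv) hxv
  · intro s hs
    simp only [Finset.mem_filter] at hs
    exact Finset.erase_insert hs.2.2
  · intro s hs
    simp only [Finset.mem_filter] at hs
    exact Finset.insert_erase hs.2

lemma leaf_transfer {A B : SimpleGraph V} (hA : ∀ v, 1 ≤ A.degree v) (hB : ∀ v, 1 ≤ B.degree v)
    {v : V} {σ : Equiv.Perm V} (h1 : σ v = v)
    (h2 : ∀ x y, x ≠ v → y ≠ v → (A.Adj x y ↔ B.Adj (σ x) (σ y))) (x : V) (hxv : x ≠ v) :
    x ∈ lf A v ↔ σ x ∈ lf B v := by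
  have h3 := perm_symm_fix h1
  rw [mem_lf' hA, mem_lf' hB]
  constructor
  · intro h t ht
    by_contra htv
    have := (h2 x (σ.symm t) hxv (perm_ne h3 htv)).2 (by simpa using ht)
    exact perm_ne h3 htv (h _ this)
  · intro h t ht
    by_contra htv
    exact perm_ne h1 htv (h _ ((h2 x t hxv htv).1 ht))

lemma sum_lf_eq {A B : SimpleGraph V} (hA : ∀ v, 1 ≤ A.degree v) (hB : ∀ v, 1 ≤ B.degree v)
    {v : V} {σ : Equiv.Perm V} (h1 : σ v = v)
    (h2 : ∀ x y, x ≠ v → y ≠ v → (A.Adj x y ↔ B.Adj (σ x) (σ y))) (g g' : V → ℤ)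
    (hg : ∀ x ∈ lf A v, g x = g' (σ x)) :
    ∑ x ∈ lf A v, g x = ∑ x ∈ lf B v, g' x := by
  refine Finset.sum_equiv σ (fun x => ?_) hg
  by_cases hx : x = v
  · subst hx
    rw [h1]
    simp [mem_lf]
  · exact leaf_transfer hA hB h1 h2 x hx

lemma main_ind (A B : SimpleGraph V) (u : V) (hS : Sh A B u) (hn : 7 ≤ Fintype.card V)
    (hA : ∀ v, 1 ≤ A.degree v)
    (hl : 0 < (Finset.univ.filter (fun x => A.degree x = 1)).card) (r : ℕ)
    (hr : Fintype.card V ≠ r + (Finset.univ.filter (fun x => A.degree x = 1)).card) :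
    (ind A r).card = (ind B r).card := by
  have hdeg := degree_eq_of_Sh A B u hS hn hA
  have hB : ∀ v, 1 ≤ B.degree v := fun v => hdeg v ▸ hA v
  have hLL : (Finset.univ.filter (fun x => B.degree x = 1)) =
      (Finset.univ.filter (fun x => A.degree x = 1)) := by
    apply Finset.filter_congr; intro x _; rw [hdeg]
  set L := Finset.univ.filter (fun x => A.degree x = 1) with hL
  have hD : ∀ r v, v ≠ u → (Dg A r v : ℤ) - Dg B r v = (ind A r).card - (ind B r).card := by
    intro r v hv
    obtain ⟨σ, h1, h2⟩ := hS v hv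
    have h3 := ind_transfer A B r σ (fun s => v ∉ s) (fun s => v ∉ s)
      (fun s => by rw [Finset.mem_map_equiv, perm_symm_fix h1])
      (fun s hs x hx y hy => h2 x y (fun h => hs (h ▸ hx)) (fun h => hs (h ▸ hy)))
    have h4 := ind_split A r v
    have h5 := ind_split B r v
    omega
  have hDu : ∀ r, (Dg A r u : ℤ) - Dg B r u =
      (r - ((Fintype.card V : ℤ) - 1)) * ((ind A r).card - (ind B r).card) := by
    intro r
    have h1 : (∑ v, (Dg A r v : ℤ)) = r * (ind A r).card := by exact_mod_cast sum_Dg A r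
    have h2 : (∑ v, (Dg B r v : ℤ)) = r * (ind B r).card := by exact_mod_cast sum_Dg B r
    have h3 : ∑ v, ((Dg A r v : ℤ) - Dg B r v) = r * (ind A r).card - r * (ind B r).card := by
      rw [Finset.sum_sub_distrib, h1, h2]
    rw [← Finset.add_sum_erase _ _ (Finset.mem_univ u),
      Finset.sum_congr rfl (fun x hx => hD r x (Finset.ne_of_mem_erase hx)), Finset.sum_const,
      Finset.card_erase_of_mem (Finset.mem_univ u), Finset.card_univ, nsmul_eq_mul,
      Nat.cast_sub (by omega)] at h3
    push_cast at h3
    linear_combination h3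
  have hleaf : ∀ v, v ≠ u → ∀ r, ∑ x ∈ lf A v, (Dg A r x : ℤ) = ∑ x ∈ lf B v, (Dg B r x : ℤ) := by
    intro v hv r
    obtain ⟨σ, h1, h2⟩ := hS v hv
    refine sum_lf_eq hA hB h1 h2 _ _ (fun x hx => ?_)
    have hxv := (mem_lf.1 hx).2
    have hx' := (mem_lf.1 ((leaf_transfer hA hB h1 h2 x hxv.ne).1 hx)).2
    rw [Dg_leaf hxv, Dg_leaf hx']
    congr 1
    refine ind_transfer A B r σ (fun s => v ∉ s ∧ x ∈ s) (fun s => v ∉ s ∧ σ x ∈ s)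
      (fun s => by rw [Finset.mem_map_equiv, Finset.mem_map_equiv, perm_symm_fix h1]; simp)
      (fun s hs x hx y hy => h2 x y (fun h => hs.1 (h ▸ hx)) (fun h => hs.1 (h ▸ hy)))
  have hleafc : ∀ v, v ≠ u → ∑ x ∈ lf A v, (1 : ℤ) = ∑ x ∈ lf B v, (1 : ℤ) := by
    intro v hv
    obtain ⟨σ, h1, h2⟩ := hS v hv
    exact sum_lf_eq hA hB h1 h2 _ _ (fun x hx => rfl)
  have hMu : (lf A u).card = (lf B u).card := by
    have e1 := sum_leaves A (fun _ => 1)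
    have e2 := sum_leaves B (fun _ => 1)
    rw [← Finset.add_sum_erase _ _ (Finset.mem_univ u)] at e1 e2
    rw [Finset.sum_congr rfl (fun x hx => hleafc x (Finset.ne_of_mem_erase hx))] at e1
    rw [hLL] at e2
    have e3 : ∑ x ∈ lf A u, (1 : ℤ) = ∑ x ∈ lf B u, (1 : ℤ) := by linarith
    simpa using e3
  have hsum : ∀ r, ∑ x ∈ L, ((Dg A r x : ℤ) - Dg B r x) =
      ∑ x ∈ lf A u, (Dg A r x : ℤ) - ∑ x ∈ lf B u, (Dg B r x : ℤ) := by
    intro r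
    have e1 := sum_leaves A (fun x => (Dg A r x : ℤ))
    have e2 := sum_leaves B (fun x => (Dg B r x : ℤ))
    rw [← Finset.add_sum_erase _ _ (Finset.mem_univ u)] at e1 e2
    rw [Finset.sum_congr rfl (fun x hx => hleaf x (Finset.ne_of_mem_erase hx) r)] at e1
    rw [hLL] at e2
    rw [Finset.sum_sub_distrib]
    linarith
  by_cases huL : u ∈ L
  · by_cases hM : (lf A u).Nonempty
    · skip
      obtain ⟨x, hx⟩ := hM
      have hxu := (mem_lf.1 hx).2
      have hu1 : A.degree u = 1 := by simpa [hL] using huL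
      have hux : u ∈ lf A x := mem_lf.2 ⟨hu1, hxu.symm⟩
      obtain ⟨σ, h1, h2⟩ := hS x hxu.ne
      have hsu := (leaf_transfer hA hB h1 h2 u hxu.ne').1 hux
      have hxs : x ∈ lf B (σ u) := mem_lf.2 ⟨by rw [← hdeg]; exact (mem_lf.1 hx).1,
        (mem_lf.1 hsu).2.symm⟩
      have hxt : ∀ t, A.Adj x t ↔ B.Adj x (σ t) := by
        intro t
        constructor
        · intro ht
          rw [lf_unique hx ht]; exact (mem_lf.1 hxs).2
        · intro ht
          rw [σ.injective (lf_unique hxs ht)]; exact hxu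
      have := ind_transfer A B r σ (fun _ => True) (fun _ => True) (fun _ => Iff.rfl) (by
        intro _ _ a _ b _
        by_cases ha : a = x
        · subst ha; rw [h1]; exact hxt b
        by_cases hb : b = x
        · subst hb; rw [h1, A.adj_comm, B.adj_comm]; exact hxt a
        exact h2 a b ha hb)
      simpa using this
    · have hM0 := Finset.not_nonempty_iff_eq_empty.1 hM
      have hM1 : lf B u = ∅ := by
        rw [← Finset.card_eq_zero, ← hMu, hM0]; rfl
      have h3 := hsum r
      rw [hM0, hM1, ← Finset.add_sum_erase _ _ huL,
        Finset.sum_congr rfl (fun x hx => hD r x (Finset.ne_of_mem_erase hx)), Finset.sum_const,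
        Finset.card_erase_of_mem huL, nsmul_eq_mul, Nat.cast_sub (by omega), hDu] at h3
      push_cast at h3
      simp only [Finset.sum_empty, sub_zero] at h3
      have h4 : ((r : ℤ) + L.card - Fintype.card V) * ((ind A r).card - (ind B r).card) = 0 := by
        linear_combination h3
      rcases mul_eq_zero.1 h4 with h | h <;> omega
  · have hsum' : ∀ r, (L.card : ℤ) * ((ind A r).card - (ind B r).card) =
        ∑ x ∈ lf A u, (Dg A r x : ℤ) - ∑ x ∈ lf B u, (Dg B r x : ℤ) := by
      intro r
      rw [← hsum, Finset.sum_congr rfl (fun x hx => hD r x (fun h => huL (h ▸ hx))),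
        Finset.sum_const, nsmul_eq_mul]
    have step : ∀ r, (∀ x ∈ lf A u, ∀ y ∈ lf B u, Dg A r x = Dg B r y) →
        (ind A r).card = (ind B r).card := by
      intro r hP
      have h3 := hsum' r
      have h4 : ∑ x ∈ lf A u, (Dg A r x : ℤ) = ∑ x ∈ lf B u, (Dg B r x : ℤ) := by
        by_cases hM : (lf A u).Nonempty
        · obtain ⟨x0, hx0⟩ := hM
          have hM' : (lf B u).Nonempty := by
            rw [← Finset.card_pos, ← hMu]; exact Finset.card_pos.2 ⟨x0, hx0⟩
          obtain ⟨y0, hy0⟩ := hM'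
          rw [Finset.sum_congr rfl (fun x hx => by rw [hP x hx y0 hy0]),
            Finset.sum_congr (g := fun _ => (Dg B r y0 : ℤ)) (rfl : lf B u = lf B u)
              (fun y hy => by rw [← hP x0 hx0 y hy, hP x0 hx0 y0 hy0]),
            Finset.sum_const, Finset.sum_const, hMu]
        · have hM0 := Finset.not_nonempty_iff_eq_empty.1 hM
          have hM1 : lf B u = ∅ := by
            rw [← Finset.card_eq_zero, ← hMu, hM0]; rfl
          rw [hM0, hM1]; rfl
      rw [h4, sub_self] at h3
      rcases mul_eq_zero.1 h3 with h | h <;> omega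
    have all : ∀ r, ∀ x ∈ lf A u, ∀ y ∈ lf B u, Dg A r x = Dg B r y := by
      intro r
      induction r with
      | zero =>
        have z : ∀ (C : SimpleGraph V) x, Dg C 0 x = 0 := by
          intro C x
          rw [Dg, Finset.card_eq_zero, Finset.filter_eq_empty_iff]
          intro s hs
          rw [Finset.card_eq_zero.1 (mem_ind.1 hs).1]
          simp
        intro x _ y _
        rw [z, z]
      | succ r ih =>
        intro x hx y hy
        have h3 := step r ih
        have h4 := hDu r
        rw [h3, sub_self, mul_zero] at h4
        have h5 := ind_split A r u
        have h6 := ind_split B r u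
        have h7 := Dg_rec hx r
        have h8 := Dg_rec hy r
        have h9 := ih x hx y hy
        omega
    exact step r (all r)

lemma kappa_eq_ind (G : SimpleGraph V) (r : ℕ) : kappa G r = (ind Gᶜ r).card := by
  rw [kappa, ← Set.ncard_coe_finset]
  congr 1
  ext s
  simp only [SimpleGraph.mem_cliqueSet_iff, SimpleGraph.isNClique_iff, Finset.mem_coe, mem_ind,
    SimpleGraph.compl_adj, SimpleGraph.isClique_iff, Set.Pairwise]
  constructor
  · rintro ⟨h1, h2⟩
    exact ⟨h2, fun x hx y hy h => h.2 (h1 hx hy h.1)⟩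
  · rintro ⟨h1, h2⟩
    refine ⟨fun x hx y hy h => ?_, h1⟩
    by_contra hc
    exact h2 x hx y hy ⟨h, hc⟩

lemma deg_compl (G A : SimpleGraph V) (hA : A = Gᶜ) (v : V) :
    deg G v + A.degree v + 1 = Fintype.card V := by
  have h1 : deg G v = G.degree v := by
    rw [deg, ← SimpleGraph.card_neighborFinset_eq_degree, ← Set.ncard_coe_finset]
    simp
  have h2 := G.degree_compl v
  have h3 := G.degree_lt_card_verts v
  rw [h1]
  have h4 : A.degree v = Fintype.card V - 1 - G.degree v := by subst hA; convert h2
  omega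

lemma final_aux (G H : SimpleGraph V) (u : V) (hS : Sh G H u) (hn : 7 ≤ Fintype.card V)
    (hle : ∀ v, deg G v + 2 ≤ Fintype.card V) (l : ℕ)
    (hl : (Finset.univ.filter (fun v => deg G v = Fintype.card V - 2)).card = l) (hlpos : 0 < l)
    (r : ℕ) (hr : Fintype.card V ≠ r + l) : kappa G r = kappa H r := by
  obtain ⟨A, hA⟩ : ∃ A, A = Gᶜ := ⟨_, rfl⟩
  have hLl : (Finset.univ.filter (fun x => A.degree x = 1)).card = l := by
    rw [← hl]
    congr 1
    apply Finset.filter_congr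
    intro v _
    have := deg_compl G A hA v
    omega
  rw [kappa_eq_ind, kappa_eq_ind, ← hA]
  refine main_ind A Hᶜ u (hA ▸ hS.compl) hn (fun v => ?_) (by omega) r (by omega)
  have := deg_compl G A hA v
  have := hle v
  omega

end Aux

theorem clique_count_of_maxDeg_eq_n_sub_two {n : ℕ} (hn : 7 ≤ n)
    (G H : SimpleGraph (Fin n)) (hshare : ShareCards G H)
    (hDelta : maxDeg G = n - 2) (l : ℕ) (hl : numMaxDeg G = l) :
    ∀ r : ℕ, 1 ≤ r → n ≠ r + l → kappa G r = kappa H r := by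
  classical
  intro r _ hr
  obtain ⟨u, w, π, hπ⟩ := hshare
  obtain ⟨τ, hτu, hτ⟩ : ∃ τ : Equiv.Perm (Fin n), τ u = w ∧
      ∀ v : {x : Fin n // x ≠ u}, τ v.1 = (π v).1 := by
    have hw : ∀ x, x ≠ u → ((π.extendSubtype) x ≠ w) := fun x hx =>
      Equiv.extendSubtype_mem π x hx
    refine ⟨π.extendSubtype, ?_, fun v => Equiv.extendSubtype_apply_of_mem π v.1 v.2⟩
    have := Equiv.extendSubtype_not_mem π u (by simp)
    simpa using this
  have hS : Sh G (H.comap τ) u := by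
    intro v hv
    obtain ⟨φ⟩ := hπ ⟨v, hv⟩
    have hv' := hτ ⟨v, hv⟩
    obtain ⟨ρ, hρ1, hρ⟩ : ∃ ρ : Equiv.Perm (Fin n), ρ v = (π ⟨v, hv⟩).1 ∧
        ∀ x : {x : Fin n // x ≠ v}, ρ x.1 = (φ x).1 := by
      refine ⟨φ.toEquiv.extendSubtype, ?_,
        fun x => Equiv.extendSubtype_apply_of_mem φ.toEquiv x.1 x.2⟩
      have := Equiv.extendSubtype_not_mem φ.toEquiv v (by simp)
      simpa using this
    refine ⟨ρ.trans τ.symm, ?_, fun x y hx hy => ?_⟩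
    · simp only [Equiv.trans_apply, hρ1, Equiv.symm_apply_eq]
      exact hv'.symm
    · simp only [Equiv.trans_apply, SimpleGraph.comap_adj, Equiv.apply_symm_apply]
      rw [hρ ⟨x, hx⟩, hρ ⟨y, hy⟩]
      exact (φ.map_rel_iff' (a := ⟨x, hx⟩) (b := ⟨y, hy⟩)).symm
  have hk : kappa H r = kappa (H.comap τ) r := by
    rw [kappa_eq_ind, kappa_eq_ind]
    have := ind_transfer (H.comap τ)ᶜ Hᶜ r τ (fun _ => True) (fun _ => True) (fun _ => Iff.rfl) (by
      intro _ _ a _ b _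
      simp [SimpleGraph.compl_adj])
    simpa using this.symm
  rw [hk]
  have hle : ∀ v, deg G v ≤ n - 2 := by
    intro v
    rw [← hDelta]
    exact Finset.le_sup (f := fun v => deg G v) (Finset.mem_univ v)
  have hlpos : 0 < l := by
    rw [← hl, numMaxDeg, Finset.card_pos]
    obtain ⟨v, _, hv⟩ := Finset.exists_mem_eq_sup (Finset.univ : Finset (Fin n))
      ⟨u, Finset.mem_univ u⟩ (fun v => deg G v)
    exact ⟨v, by simp [maxDeg, hv]⟩
  refine final_aux G (H.comap τ) u hS (by simpa using hn) (fun v => ?_) l ?_ hlpos r (by simpa using hr)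
  · have := hle v
    rw [Fintype.card_fin]
    omega
  · rw [← hl, numMaxDeg, hDelta, Fintype.card_fin]
end
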